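/- (Uhlenbeck gauge in two dimensions) There exist σ > 0 and c > 0 such that for every Ω ∈ L²(B², so(n) ⊗ Λ¹ℝ²) satisfying ‖Ω‖_{L²(B²)} < σ, there exist P ∈ W^{1,2}(B², SO(n)) and ξ ∈ W^{1,2}(B², so(n)) such that Ω = P^{-1}∇^⊥ξ P + P^{-1}∇P on B², together with the estimate ‖ξ‖_{W^{1,2}(B²)} + ‖∇P‖_{L²(B²)} ≤ c‖Ω‖_{L²(B²)}. -/

import Mathlib

open MeasureTheory Set
open scoped ENNReal NNReal
noncomputable section

attribute [local instance] Matrix.frobeniusNormedAddCommGroup Matrix.frobeniusNormedSpace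

namespace CL

abbrev Euc (N : ℕ) := EuclideanSpace ℝ (Fin N)
abbrev Vec (n : ℕ) := Fin n → ℝ
abbrev Mat (n : ℕ) := Matrix (Fin n) (Fin n) ℝ

/-- the open unit ball `B^N ⊆ ℝ^N` -/
def ballUnit (N : ℕ) : Set (Euc N) := Metric.ball 0 1

/-- the concentric open ball of radius `r` -/
def ballR (N : ℕ) (r : ℝ) : Set (Euc N) := Metric.ball 0 r

variable {N : ℕ} {E : Type*} [NormedAddCommGroup E] [NormedSpace ℝ E]

/-- classical partial derivative in the `i`-th coordinate direction -/
def pd (i : Fin N) (f : Euc N → E) : Euc N → E :=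
  fun x => fderiv ℝ f x (EuclideanSpace.single i 1)

/-- iterated classical partial derivative along a multi-index -/
def mderiv (α : Fin N → ℕ) (f : Euc N → E) : Euc N → E :=
  (List.finRange N).foldr (fun i g => (pd i)^[α i] g) f

/-- degree of a multi-index -/
def mdeg {N : ℕ} (α : Fin N → ℕ) : ℕ := ∑ i, α i

/-- the multi-index `e_i` -/
def single1 (i : Fin N) : Fin N → ℕ := fun j => if j = i then 1 else 0

/-- Laplacian -/
def lap (f : Euc N → E) : Euc N → E := fun x => ∑ i, pd i (pd i f) x

/-- iterated Laplacian `Δ^k` -/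
def polylap : ℕ → (Euc N → E) → Euc N → E
  | 0, f => f
  | k + 1, f => lap (polylap k f)

/-- gradient / exterior derivative of a function, as a `1`-form -/
def gradf (f : Euc N → E) : Euc N → Fin N → E := fun x i => pd i f x

/-- codifferential (divergence) of a `1`-form -/
def codiff1 (ω : Euc N → Fin N → E) : Euc N → E := fun x => ∑ i, pd i (fun y => ω y i) x

/-- test functions on an open set -/
structure IsTestFun (Ω : Set (Euc N)) (φ : Euc N → ℝ) : Prop where
  smooth : ContDiff ℝ (⊤ : ℕ∞) φ
  supp_subset : tsupport φ ⊆ Ω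
  supp_compact : IsCompact (tsupport φ)

/-- `g` is the `α`-th weak derivative of `f` on `Ω` -/
def HasWeakDeriv (Ω : Set (Euc N)) (α : Fin N → ℕ) (f g : Euc N → E) : Prop :=
  ∀ φ : Euc N → ℝ, IsTestFun Ω φ →
    ∫ x in Ω, mderiv α φ x • f x = ((-1 : ℝ) ^ mdeg α) • ∫ x in Ω, φ x • g x

/-- distribution function of `f` -/
def distFn {X : Type*} [MeasurableSpace X] (μ : Measure X) (f : X → E) (t : ℝ≥0∞) : ℝ≥0∞ :=
  μ {x | t < (‖f x‖₊ : ℝ≥0∞)}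

/-- decreasing rearrangement of `f` -/
def rearr {X : Type*} [MeasurableSpace X] (μ : Measure X) (f : X → E) (s : ℝ) : ℝ≥0∞ :=
  sInf {t : ℝ≥0∞ | distFn μ f t ≤ ENNReal.ofReal s}

/-- the Lorentz quasinorm `‖f‖_{L^{p,q}}` -/
def lorentzNorm {X : Type*} [MeasurableSpace X] (p q : ℝ≥0∞) (μ : Measure X) (f : X → E) :
    ℝ≥0∞ :=
  if q = ⊤ then ⨆ s : ℝ, ENNReal.ofReal s ^ (1 / p).toReal * rearr μ f s
  else (∫⁻ s in Ioi (0 : ℝ), (ENNReal.ofReal s ^ (1 / p).toReal * rearr μ f s) ^ q.toReal *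
      ENNReal.ofReal s⁻¹) ^ (1 / q.toReal)

/-- Lorentz quasinorm on a subset of `ℝ^N` (w.r.t. Lebesgue measure) -/
def lorentzNormOn (p q : ℝ≥0∞) (Ω : Set (Euc N)) (f : Euc N → E) : ℝ≥0∞ :=
  lorentzNorm p q (volume.restrict Ω) f

/-- membership in the Lorentz space `L^{p,q}(Ω)` -/
def MemLorentz (p q : ℝ≥0∞) (Ω : Set (Euc N)) (f : Euc N → E) : Prop :=
  AEStronglyMeasurable f (volume.restrict Ω) ∧ lorentzNormOn p q Ω f < ⊤

/-- the finset of multi-indices of degree at most `k` (coded with bounded entries) -/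
def mIdx (N k : ℕ) : Finset (Fin N → Fin (k + 1)) :=
  Finset.univ.filter fun α => (∑ i, (α i : ℕ)) ≤ k

/-- decode a bounded multi-index -/
def toMI {N k : ℕ} (α : Fin N → Fin (k + 1)) : Fin N → ℕ := fun i => (α i : ℕ)

/-- membership in the Lorentz–Sobolev space `W^{k,p,q}(Ω)`:
all weak derivatives up to order `k` exist and lie in `L^{p,q}(Ω)` -/
def MemSL (k : ℕ) (p q : ℝ≥0∞) (Ω : Set (Euc N)) (f : Euc N → E) : Prop :=
  ∃ g : (Fin N → ℕ) → Euc N → E,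
    (∀ α, mdeg α ≤ k → HasWeakDeriv Ω α f (g α)) ∧
    ∀ α, mdeg α ≤ k → MemLorentz p q Ω (g α)

/-- the Lorentz–Sobolev norm `‖f‖_{W^{k,p,q}(Ω)}` -/
def slNorm (k : ℕ) (p q : ℝ≥0∞) (Ω : Set (Euc N)) (f : Euc N → E) : ℝ≥0∞ :=
  sInf {M | ∃ g : (Fin N → ℕ) → Euc N → E,
    (∀ α, mdeg α ≤ k → HasWeakDeriv Ω α f (g α)) ∧
    M = ∑ α ∈ mIdx N k, lorentzNormOn p q Ω (g (toMI α))}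

/-- the top-order homogeneous Lorentz–Sobolev seminorm `‖D^k f‖_{L^{p,q}(Ω)}` -/
def slTopNorm (k : ℕ) (p q : ℝ≥0∞) (Ω : Set (Euc N)) (f : Euc N → E) : ℝ≥0∞ :=
  sInf {M | ∃ g : (Fin N → ℕ) → Euc N → E,
    (∀ α, mdeg α = k → HasWeakDeriv Ω α f (g α)) ∧
    M = ∑ α ∈ (mIdx N k).filter (fun α => (∑ i, (α i : ℕ)) = k),
        lorentzNormOn p q Ω (g (toMI α))}

/-- membership (of a measurable function, viewed as a distribution) in the negative
Lorentz–Sobolev space `W^{-k,p,q}(Ω)`, via representations `f = Σ_{|α| ≤ k} ∂^α g_α` -/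
def MemSLneg (k : ℕ) (p q : ℝ≥0∞) (Ω : Set (Euc N)) (f : Euc N → E) : Prop :=
  ∃ g : (Fin N → ℕ) → Euc N → E,
    (∀ α, mdeg α ≤ k → MemLorentz p q Ω (g α)) ∧
    ∀ φ : Euc N → ℝ, IsTestFun Ω φ →
      ∫ x in Ω, φ x • f x =
        ∑ α ∈ mIdx N k,
          ((-1 : ℝ) ^ mdeg (toMI α)) • ∫ x in Ω, mderiv (toMI α) φ x • g (toMI α) x

/-- the norm of the negative Lorentz–Sobolev space `W^{-k,p,q}(Ω)` -/
def slNegNorm (k : ℕ) (p q : ℝ≥0∞) (Ω : Set (Euc N)) (f : Euc N → E) : ℝ≥0∞ :=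
  sInf {M | ∃ g : (Fin N → ℕ) → Euc N → E,
    (∀ φ : Euc N → ℝ, IsTestFun Ω φ →
      ∫ x in Ω, φ x • f x =
        ∑ α ∈ mIdx N k,
          ((-1 : ℝ) ^ mdeg (toMI α)) • ∫ x in Ω, mderiv (toMI α) φ x • g (toMI α) x) ∧
    M = ∑ α ∈ mIdx N k, lorentzNormOn p q Ω (g (toMI α))}

/-- membership in `W^{s,p,q}(Ω)` for an integer order `s` -/
def MemSLz (s : ℤ) (p q : ℝ≥0∞) (Ω : Set (Euc N)) (f : Euc N → E) : Prop :=
  if 0 ≤ s then MemSL s.toNat p q Ω f else MemSLneg (-s).toNat p q Ω f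

/-- the `W^{s,p,q}(Ω)`-norm for an integer order `s` -/
def slzNorm (s : ℤ) (p q : ℝ≥0∞) (Ω : Set (Euc N)) (f : Euc N → E) : ℝ≥0∞ :=
  if 0 ≤ s then slNorm s.toNat p q Ω f else slNegNorm (-s).toNat p q Ω f

/-- `A ∈ SO(n)` -/
def IsSO {n : ℕ} (A : Mat n) : Prop := A.transpose * A = 1 ∧ A.det = 1

/-- `A ∈ so(n)`, i.e. `A` is antisymmetric -/
def IsAntisym {n : ℕ} (A : Mat n) : Prop := A.transpose = -A


/-- `∇^⊥`-style rotation of a pair: `perp v = (-(v 1), v 0)` -/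
def perp {E : Type*} [Neg E] (v : Fin 2 → E) : Fin 2 → E := ![-(v 1), v 0]

end CL

namespace CL

open Filter Topology

/-- Cauchy–Schwarz for lower Lebesgue integrals, in squared form. -/
lemma lintegral_mul_sq_le {α : Type*} [MeasurableSpace α] (μ : Measure α) {f g : α → ℝ≥0∞}
    (hf : AEMeasurable f μ) (hg : AEMeasurable g μ) :
    (∫⁻ a, f a * g a ∂μ) ^ 2 ≤ (∫⁻ a, f a ^ 2 ∂μ) * ∫⁻ a, g a ^ 2 ∂μ := by
  have h := ENNReal.lintegral_mul_le_Lp_mul_Lq μ Real.HolderConjugate.two_two hf hg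
  have h2 := pow_le_pow_left' h 2
  refine h2.trans_eq ?_
  rw [mul_pow, ← ENNReal.rpow_natCast, ← ENNReal.rpow_natCast, ← ENNReal.rpow_mul,
    ← ENNReal.rpow_mul]
  norm_num

/-- The square of the norm of an integral is controlled by the total mass and the integral of the
square. -/
lemma enorm_integral_sq_le {α : Type*} [MeasurableSpace α] {E : Type*} [NormedAddCommGroup E]
    [NormedSpace ℝ E] (μ : Measure α) {f : α → E} (hf : AEStronglyMeasurable f μ) :
    ‖∫ a, f a ∂μ‖ₑ ^ 2 ≤ μ univ * ∫⁻ a, ‖f a‖ₑ ^ 2 ∂μ := by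
  have h := lintegral_mul_sq_le μ (f := fun _ => 1) (g := fun a => ‖f a‖ₑ) aemeasurable_const
    hf.enorm
  simp only [one_mul, one_pow, lintegral_one] at h
  exact (pow_le_pow_left' (enorm_integral_le_lintegral_enorm f) 2).trans h

/-- The average of `φ` over the segments `[y, y + h]`. -/
def segAvg {F : Type*} [NormedAddCommGroup F] [NormedSpace ℝ F] (h : Euc 2) (φ : Euc 2 → F) :
    Euc 2 → F :=
  fun y => ∫ t in (0 : ℝ)..1, φ (y + t • h)

section segAvg

variable {F : Type} [NormedAddCommGroup F] [NormedSpace ℝ F] (h : Euc 2) {φ : Euc 2 → F}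

lemma continuous_segAvg (hφ : Continuous φ) : Continuous (segAvg h φ) := by
  apply intervalIntegral.continuous_parametric_intervalIntegral_of_continuous'
  fun_prop

lemma hasFDerivAt_segAvg (hφ : ContDiff ℝ 1 φ) (y : Euc 2) :
    HasFDerivAt (segAvg h φ) (segAvg h (fderiv ℝ φ) y) y := by
  have hc : Continuous (fderiv ℝ φ) := hφ.continuous_fderiv one_ne_zero
  have hφc := hφ.continuous
  obtain ⟨C, hC⟩ := (isCompact_closedBall y (1 + ‖h‖)).exists_bound_of_continuousOn hc.continuousOn
  refine intervalIntegral.hasFDerivAt_integral_of_dominated_of_fderiv_le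
    (F := fun y t => φ (y + t • h)) (F' := fun y t => fderiv ℝ φ (y + t • h))
    (bound := fun _ => C) (Metric.ball_mem_nhds y one_pos) ?_ ?_ ?_ ?_ ?_ ?_
  · refine Filter.Eventually.of_forall fun x => ?_
    exact Continuous.aestronglyMeasurable (by fun_prop)
  · exact Continuous.intervalIntegrable (by fun_prop) _ _
  · exact Continuous.aestronglyMeasurable (by fun_prop)
  · refine Filter.Eventually.of_forall fun t ht x hx => hC _ ?_
    rw [uIoc_of_le zero_le_one] at ht
    rw [mem_closedBall_iff_norm]
    rw [mem_ball_iff_norm] at hx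
    calc ‖x + t • h - y‖ = ‖(x - y) + t • h‖ := by congr 1; abel
      _ ≤ ‖x - y‖ + ‖t • h‖ := norm_add_le _ _
      _ ≤ 1 + ‖h‖ := by
        rw [norm_smul, Real.norm_of_nonneg ht.1.le]
        gcongr
        exact mul_le_of_le_one_left (norm_nonneg _) ht.2
  · exact intervalIntegrable_const
  · refine Filter.Eventually.of_forall fun t _ x _ => ?_
    have := (hφ.differentiable one_ne_zero (x + t • h)).hasFDerivAt
    simpa [Function.comp_def] using this.comp x ((hasFDerivAt_id x).add_const (t • h))

lemma contDiff_segAvg_nat (n : ℕ) : ∀ {F : Type} [NormedAddCommGroup F] [NormedSpace ℝ F]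
    {φ : Euc 2 → F}, ContDiff ℝ n φ → ContDiff ℝ n (segAvg h φ) := by
  induction n with
  | zero =>
    intro F _ _ φ hφ
    exact contDiff_zero.2 (continuous_segAvg h (contDiff_zero.1 hφ))
  | succ n ih =>
    intro F _ _ φ hφ
    have h1 : ContDiff ℝ 1 φ := hφ.of_le (by exact_mod_cast Nat.le_add_left 1 n)
    have hd := hasFDerivAt_segAvg h h1
    push_cast at hφ ⊢
    rw [contDiff_succ_iff_fderiv] at hφ ⊢
    refine ⟨fun y => (hd y).differentiableAt, by simp, ?_⟩
    have : fderiv ℝ (segAvg h φ) = segAvg h (fderiv ℝ φ) := funext fun y => (hd y).fderiv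
    rw [this]
    exact ih hφ.2.2

lemma contDiff_segAvg (hφ : ContDiff ℝ (⊤ : ℕ∞) φ) : ContDiff ℝ (⊤ : ℕ∞) (segAvg h φ) :=
  contDiff_infty.2 fun n => contDiff_segAvg_nat h n (contDiff_infty.1 hφ n)

lemma pd_segAvg [CompleteSpace F] (hφ : ContDiff ℝ 1 φ) (i : Fin 2) :
    pd i (segAvg h φ) = segAvg h (pd i φ) := by
  funext y
  have hc : Continuous (fderiv ℝ φ) := hφ.continuous_fderiv one_ne_zero
  rw [pd, (hasFDerivAt_segAvg h hφ y).fderiv, segAvg, ContinuousLinearMap.intervalIntegral_apply]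
  · rfl
  · exact Continuous.intervalIntegrable (by fun_prop) _ _

lemma fderiv_segAvg_apply [CompleteSpace F] (hφ : ContDiff ℝ 1 φ) (y : Euc 2) :
    fderiv ℝ (segAvg h φ) y h = φ (y + h) - φ y := by
  have hc : Continuous (fderiv ℝ φ) := hφ.continuous_fderiv one_ne_zero
  rw [(hasFDerivAt_segAvg h hφ y).fderiv, segAvg, ContinuousLinearMap.intervalIntegral_apply]
  · rw [intervalIntegral.integral_eq_sub_of_hasDerivAt (f := fun t : ℝ => φ (y + t • h))]
    · simp
    · intro t _
      have h1 := (hφ.differentiable one_ne_zero (y + t • h)).hasFDerivAt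
      have h2 : HasDerivAt (fun t : ℝ => y + t • h) h t := by
        simpa using ((hasDerivAt_id t).smul_const h).const_add y
      exact h1.comp_hasDerivAt t h2
    · exact Continuous.intervalIntegrable (by fun_prop) _ _
  · exact Continuous.intervalIntegrable (by fun_prop) _ _

lemma lintegral_segAvg_sq_le (hφ : StronglyMeasurable φ) :
    ∫⁻ y, ‖segAvg h φ y‖ₑ ^ 2 ≤ ∫⁻ y, ‖φ y‖ₑ ^ 2 := by
  have hm : StronglyMeasurable fun z : Euc 2 × ℝ => φ (z.1 + z.2 • h) :=
    hφ.comp_measurable (by fun_prop)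
  have h1 : ∀ y, ‖segAvg h φ y‖ₑ ^ 2 ≤ ∫⁻ t in Ioc (0 : ℝ) 1, ‖φ (y + t • h)‖ₑ ^ 2 := by
    intro y
    rw [segAvg, intervalIntegral.integral_of_le zero_le_one]
    refine (enorm_integral_sq_le _
      (hm.comp_measurable measurable_prodMk_left).aestronglyMeasurable).trans_eq ?_
    simp
  refine (lintegral_mono h1).trans_eq ?_
  rw [lintegral_lintegral_swap (hm.enorm.pow_const 2).aemeasurable]
  simp only [lintegral_add_right_eq_self (fun y => ‖φ y‖ₑ ^ 2)]
  simp

end segAvg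

lemma fderiv_apply_eq_sum_pd {F : Type*} [NormedAddCommGroup F] [NormedSpace ℝ F] (f : Euc 2 → F)
    (x h : Euc 2) : fderiv ℝ f x h = ∑ i, h i • pd i f x := by
  have : h = ∑ i, h i • (EuclideanSpace.single i (1 : ℝ) : Euc 2) := by
    ext j
    fin_cases j <;> simp
  conv_lhs => rw [this]
  simp [pd]

lemma eLpNorm_two_sq {α E : Type*} [MeasurableSpace α] [NormedAddCommGroup E] (μ : Measure α)
    (f : α → E) : eLpNorm f 2 μ ^ 2 = ∫⁻ x, ‖f x‖ₑ ^ 2 ∂μ := by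
  have := eLpNorm_nnreal_pow_eq_lintegral (μ := μ) (f := f) (p := 2) (by norm_num)
  simpa using this

lemma lintegral_sq_lt_top {α E : Type*} [MeasurableSpace α] [NormedAddCommGroup E] {μ : Measure α}
    {f : α → E} (hf : MemLp f 2 μ) : ∫⁻ x, ‖f x‖ₑ ^ 2 ∂μ < ∞ := by
  rw [← eLpNorm_two_sq]
  exact ENNReal.pow_lt_top hf.2

lemma memLp_two_of_lintegral_sq_lt_top {α E : Type*} [MeasurableSpace α] [NormedAddCommGroup E]
    {μ : Measure α} {f : α → E} (hf : AEStronglyMeasurable f μ)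
    (h : ∫⁻ x, ‖f x‖ₑ ^ 2 ∂μ < ∞) : MemLp f 2 μ := by
  refine ⟨hf, ?_⟩
  rw [← eLpNorm_two_sq] at h
  by_contra hc
  rw [not_lt, top_le_iff] at hc
  simp [hc] at h

lemma integrable_mul_of_memLp {α : Type*} [MeasurableSpace α] {μ : Measure α} {f g : α → ℝ}
    (hf : MemLp f 2 μ) (hg : MemLp g 2 μ) : Integrable (fun x => f x * g x) μ :=
  hf.integrable_mul hg

lemma IsTestFun.continuous {Ω : Set (Euc 2)} {φ : Euc 2 → ℝ} (h : IsTestFun Ω φ) : Continuous φ :=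
  h.smooth.continuous

lemma IsTestFun.memLp {Ω : Set (Euc 2)} {φ : Euc 2 → ℝ} (h : IsTestFun Ω φ) (p : ℝ≥0∞)
    (μ : Measure (Euc 2)) [IsFiniteMeasureOnCompacts μ] : MemLp φ p μ :=
  h.continuous.memLp_of_hasCompactSupport h.supp_compact

lemma IsTestFun.eq_zero {Ω : Set (Euc 2)} {φ : Euc 2 → ℝ} (h : IsTestFun Ω φ) {x : Euc 2}
    (hx : x ∉ Ω) : φ x = 0 :=
  image_eq_zero_of_notMem_tsupport fun h' => hx (h.supp_subset h')

lemma IsTestFun.zero (Ω : Set (Euc 2)) : IsTestFun Ω (fun _ => 0) where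
  smooth := contDiff_const
  supp_subset := by simp [tsupport, Function.support]
  supp_compact := by simp [tsupport, Function.support]

lemma IsTestFun.add {Ω : Set (Euc 2)} {φ ψ : Euc 2 → ℝ} (hφ : IsTestFun Ω φ)
    (hψ : IsTestFun Ω ψ) : IsTestFun Ω (fun x => φ x + ψ x) where
  smooth := hφ.smooth.add hψ.smooth
  supp_subset := (tsupport_add φ ψ).trans (union_subset hφ.supp_subset hψ.supp_subset)
  supp_compact := HasCompactSupport.add (f := φ) (f' := ψ) hφ.supp_compact hψ.supp_compact

lemma IsTestFun.mul_left {Ω : Set (Euc 2)} {φ ψ : Euc 2 → ℝ} (hφ : IsTestFun Ω φ)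
    (hψ : ContDiff ℝ (⊤ : ℕ∞) ψ) : IsTestFun Ω (fun x => ψ x * φ x) where
  smooth := hψ.mul hφ.smooth
  supp_subset := (tsupport_mul_subset_right (f := ψ) (g := φ)).trans hφ.supp_subset
  supp_compact := HasCompactSupport.mul_left (f := ψ) (f' := φ) hφ.supp_compact

/-- An `L²` function whose pairing with every test function on the open set `U` is controlled by
the `L²` norm of the test function has correspondingly small `L²` norm. -/
lemma lintegral_sq_le_of_forall_test {U : Set (Euc 2)} (hU : IsOpen U) {f : Euc 2 → ℝ}
    (hf : MemLp f 2 (volume.restrict U)) (C : ℝ≥0)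
    (h : ∀ φ, IsTestFun U φ →
      ‖∫ x in U, f x * φ x‖ₑ ^ 2 ≤ C * ∫⁻ x in U, ‖φ x‖ₑ ^ 2) :
    ∫⁻ x in U, ‖f x‖ₑ ^ 2 ≤ C := by
  set ν := volume.restrict U with hν
  let S : Submodule ℝ (Lp ℝ 2 ν) :=
    { carrier := {u | ∃ φ, IsTestFun U φ ∧ u =ᵐ[ν] φ}
      add_mem' := by
        rintro u v ⟨φ, hφ, hu⟩ ⟨ψ, hψ, hv⟩
        exact ⟨_, hφ.add hψ, (Lp.coeFn_add u v).trans (hu.add hv)⟩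
      zero_mem' := ⟨_, IsTestFun.zero U, Lp.coeFn_zero _ _ _⟩
      smul_mem' := by
        rintro c u ⟨φ, hφ, hu⟩
        exact ⟨_, hφ.mul_left (ψ := fun _ => c) contDiff_const,
          (Lp.coeFn_smul c u).trans (hu.const_smul c)⟩ }
  have hS : S.topologicalClosure = ⊤ := by
    rw [Submodule.topologicalClosure_eq_top_iff, Submodule.eq_bot_iff]
    intro u hu
    rw [Submodule.mem_orthogonal] at hu
    have hul : LocallyIntegrableOn u U volume := by
      intro x hx
      obtain ⟨r, hr, hrU⟩ := Metric.isOpen_iff.1 hU x hx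
      refine ⟨Metric.ball x r, mem_nhdsWithin_of_mem_nhds (Metric.ball_mem_nhds x hr), ?_⟩
      have h1 : MemLp u 2 (volume.restrict (Metric.ball x r)) :=
        (Lp.memLp u).mono_measure (Measure.restrict_mono hrU le_rfl)
      have : IsFiniteMeasure (volume.restrict (Metric.ball x r)) :=
        ⟨by
          rw [Measure.restrict_apply_univ]
          exact (Metric.isBounded_ball (x := x) (r := r)).measure_lt_top⟩
      exact h1.integrable one_le_two
    have h0 := hU.ae_eq_zero_of_integral_contDiff_smul_eq_zero hul (fun φ h1 h2 h3 => by
      have hφ : IsTestFun U φ := ⟨h1, h3, h2⟩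
      have hφL : MemLp φ 2 ν := (hφ.memLp 2 volume).restrict U
      have h4 := hu (hφL.toLp φ) ⟨φ, hφ, MemLp.coeFn_toLp _⟩
      rw [L2.inner_def] at h4
      have h5 : ∫ x, φ x • u x = ∫ x in U, φ x • u x := by
        rw [setIntegral_eq_integral_of_forall_compl_eq_zero]
        intro x hx
        simp [hφ.eq_zero hx]
      rw [h5, ← h4]
      apply integral_congr_ae
      filter_upwards [MemLp.coeFn_toLp hφL] with x hx
      simp [hx, mul_comm])
    rw [Lp.eq_zero_iff_ae_eq_zero]
    exact (ae_restrict_iff' hU.measurableSet).2 h0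
  set F := hf.toLp f with hF
  have hsq : ∀ {k : Euc 2 → ℝ} (hk : MemLp k 2 ν),
      ENNReal.ofReal (‖hk.toLp k‖ ^ 2) = ∫⁻ x, ‖k x‖ₑ ^ 2 ∂ν := by
    intro k hk
    rw [← eLpNorm_two_sq, Lp.norm_toLp, ← ENNReal.toReal_pow,
      ENNReal.ofReal_toReal (ENNReal.pow_ne_top hk.2.ne)]
  have hcl : ∀ u : Lp ℝ 2 ν, ‖inner ℝ F u‖ ^ 2 ≤ C * ‖u‖ ^ 2 := by
    intro u
    have hclosed : IsClosed {u : Lp ℝ 2 ν | ‖inner ℝ F u‖ ^ 2 ≤ C * ‖u‖ ^ 2} :=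
      isClosed_le (by fun_prop) (by fun_prop)
    have hsub : (S : Set (Lp ℝ 2 ν)) ⊆ {u : Lp ℝ 2 ν | ‖inner ℝ F u‖ ^ 2 ≤ C * ‖u‖ ^ 2} := by
      rintro u ⟨φ, hφ, hu⟩
      have hu' : u = (hφ.memLp 2 ν).toLp φ := by
        apply Lp.ext
        exact hu.trans (MemLp.coeFn_toLp _).symm
      have h1 := h φ hφ
      have h2 : inner ℝ F u = ∫ x, f x * φ x ∂ν := by
        rw [L2.inner_def]
        apply integral_congr_ae
        filter_upwards [MemLp.coeFn_toLp hf, hu] with x hx hx'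
        rw [hF, hx, hx']
        simp [mul_comm]
      rw [← h2, ← hsq (hφ.memLp 2 ν), ← hu', ← ofReal_norm,
        ← ENNReal.ofReal_pow (by positivity),
        ← ENNReal.ofReal_coe_nnreal, ← ENNReal.ofReal_mul (by positivity)] at h1
      exact (ENNReal.ofReal_le_ofReal_iff (by positivity)).1 h1
    have := hclosed.closure_subset_iff.2 hsub
    apply this
    have hm : u ∈ S.topologicalClosure := by rw [hS]; trivial
    exact hm
  have hFF := hcl F
  rw [real_inner_self_eq_norm_sq, Real.norm_of_nonneg (by positivity)] at hFF
  rw [← hsq hf, ← ENNReal.ofReal_coe_nnreal]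
  apply ENNReal.ofReal_le_ofReal
  by_contra! hlt
  have hpos : 0 < ‖F‖ ^ 2 := C.2.trans_lt hlt
  nlinarith

/-- The scalar weak derivative on the unit disc. -/
def WD (i : Fin 2) (f g : Euc 2 → ℝ) : Prop :=
  ∀ φ, IsTestFun (ballUnit 2) φ →
    ∫ x in ballUnit 2, pd i φ x * f x = -∫ x in ballUnit 2, φ x * g x

lemma isOpen_ballUnit : IsOpen (ballUnit 2) := Metric.isOpen_ball

lemma measurableSet_ballUnit : MeasurableSet (ballUnit 2) := measurableSet_ball

instance : IsFiniteMeasure (volume.restrict (ballUnit 2)) :=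
  ⟨by
    rw [Measure.restrict_apply_univ]
    exact (Metric.isBounded_ball (x := (0 : Euc 2))).measure_lt_top⟩

lemma IsTestFun.pd {Ω : Set (Euc 2)} {φ : Euc 2 → ℝ} (hφ : IsTestFun Ω φ) (i : Fin 2) :
    IsTestFun Ω (pd i φ) where
  smooth := by
    have := (contDiff_infty_iff_fderiv.1 hφ.smooth).2
    exact this.clm_apply contDiff_const
  supp_subset := (tsupport_fderiv_apply_subset ℝ _).trans hφ.supp_subset
  supp_compact := hφ.supp_compact.of_isClosed_subset (isClosed_tsupport _)
    (tsupport_fderiv_apply_subset ℝ _)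

lemma IsTestFun.segAvg {φ : Euc 2 → ℝ} {h : Euc 2}
    (hφ : IsTestFun (ballUnit 2 ∩ {x | x - h ∈ ballUnit 2}) φ) :
    IsTestFun (ballUnit 2) (segAvg h φ) := by
  set K : Set (Euc 2) := (fun p : Euc 2 × ℝ => p.1 - p.2 • h) '' (tsupport φ ×ˢ Icc (0 : ℝ) 1)
    with hK
  have hKc : IsCompact K := (hφ.supp_compact.prod isCompact_Icc).image (by fun_prop)
  have hKB : K ⊆ ballUnit 2 := by
    rintro _ ⟨⟨x, t⟩, ⟨hx, ht⟩, rfl⟩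
    obtain ⟨h1, h2⟩ := hφ.supp_subset hx
    have := (convex_ball (0 : Euc 2) 1) h1 h2 (sub_nonneg.2 ht.2) ht.1 (by ring)
    have e : (1 - t) • x + t • (x - h) = x - t • h := by module
    change x - t • h ∈ Metric.ball 0 1
    exact e ▸ this
  have hs : tsupport (CL.segAvg h φ) ⊆ K := by
    apply closure_minimal _ hKc.isClosed
    intro y hy
    by_contra hyK
    apply hy
    rw [CL.segAvg, intervalIntegral.integral_of_le zero_le_one]
    apply setIntegral_eq_zero_of_forall_eq_zero
    intro t ht
    by_contra hne
    exact hyK ⟨(y + t • h, t), ⟨subset_tsupport _ hne, ht.1.le, ht.2⟩, by simp⟩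
  exact ⟨contDiff_segAvg h hφ.smooth, hs.trans hKB, hKc.of_isClosed_subset (isClosed_tsupport _) hs⟩

lemma lintegral_translation_sq_le {f : Euc 2 → ℝ} {g : Fin 2 → Euc 2 → ℝ}
    (hf : MemLp f 2 (volume.restrict (ballUnit 2)))
    (hg : ∀ i, MemLp (g i) 2 (volume.restrict (ballUnit 2)))
    (hfg : ∀ i, WD i f (g i)) (h : Euc 2) :
    ∫⁻ x in ballUnit 2 ∩ {x | x - h ∈ ballUnit 2}, ‖f x - f (x - h)‖ₑ ^ 2 ≤
      ‖h‖ₑ ^ 2 * ∫⁻ x in ballUnit 2, ∑ i, ‖g i x‖ₑ ^ 2 := by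
  set U := ballUnit 2 ∩ {x | x - h ∈ ballUnit 2} with hUdef
  have hpre : IsOpen {x | x - h ∈ ballUnit 2} := isOpen_ballUnit.preimage (by fun_prop)
  have hU : IsOpen U := isOpen_ballUnit.inter hpre
  have hUB : U ⊆ ballUnit 2 := inter_subset_left
  have hG : ∫⁻ x in ballUnit 2, ∑ i, ‖g i x‖ₑ ^ 2 < ∞ := by
    rw [lintegral_finsetSum' _ fun i _ => (hg i).1.enorm.pow_const 2]
    exact ENNReal.sum_lt_top.2 fun i _ => lintegral_sq_lt_top (hg i)
  set F := (ballUnit 2).indicator f with hFdef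
  have hF : MemLp F 2 volume := (memLp_indicator_iff_restrict measurableSet_ballUnit).2 hf
  have hFh : MemLp (fun x => F (x - h)) 2 volume :=
    hF.comp_measurePreserving (measurePreserving_sub_right volume h)
  have hcongr : ∀ x ∈ U, f x - f (x - h) = F x - F (x - h) := by
    intro x hx
    rw [hFdef, indicator_of_mem hx.1, indicator_of_mem (by exact hx.2)]
  rw [setLIntegral_congr_fun hU.measurableSet
    (fun x hx => by rw [hcongr x hx] : EqOn _ (fun x => ‖F x - F (x - h)‖ₑ ^ 2) U)]
  have hC : ‖h‖ₑ ^ 2 * ∫⁻ x in ballUnit 2, ∑ i, ‖g i x‖ₑ ^ 2 ≠ ∞ :=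
    ENNReal.mul_ne_top (ENNReal.pow_ne_top enorm_ne_top) hG.ne
  lift (‖h‖ₑ ^ 2 * ∫⁻ x in ballUnit 2, ∑ i, ‖g i x‖ₑ ^ 2) to ℝ≥0 using hC with C hCeq
  refine lintegral_sq_le_of_forall_test hU ((hF.sub hFh).restrict U) C fun φ hφ => ?_
  simp only [Pi.sub_apply]
  rw [hCeq]
  have hΦ := hφ.segAvg
  have hφ2 := hφ.memLp 2 volume
  have hφh : MemLp (fun x => φ (x + h)) 2 volume :=
    hφ2.comp_measurePreserving (measurePreserving_add_right volume h)
  have e1 : ∫ x in U, (F x - F (x - h)) * φ x = -∫ x in ballUnit 2, f x * (φ (x + h) - φ x) := by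
    have a1 : ∫ x in U, (F x - F (x - h)) * φ x = ∫ x, (F x - F (x - h)) * φ x :=
      setIntegral_eq_integral_of_forall_compl_eq_zero fun x hx => by simp [hφ.eq_zero hx]
    have a2 : ∫ x in ballUnit 2, f x * (φ (x + h) - φ x) = ∫ x, F x * (φ (x + h) - φ x) := by
      rw [← integral_indicator measurableSet_ballUnit]
      congr 1
      funext x
      by_cases hx : x ∈ ballUnit 2 <;> simp [hFdef, hx]
    have a3 : ∫ x, F (x - h) * φ x = ∫ x, F x * φ (x + h) := by
      rw [← integral_add_right_eq_self _ h]
      simp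
    simp only [sub_mul, mul_sub] at a1 a2 ⊢
    rw [a1, a2, integral_sub (integrable_mul_of_memLp hF hφ2) (integrable_mul_of_memLp hFh hφ2),
      integral_sub (integrable_mul_of_memLp hF hφh) (integrable_mul_of_memLp hF hφ2), a3]
    ring
  have e2 : ∫ x in ballUnit 2, f x * (φ (x + h) - φ x) =
      -∫ x in ballUnit 2, segAvg h φ x * ∑ i, h i * g i x := by
    have b1 : ∀ x, f x * (φ (x + h) - φ x) = ∑ i, h i * (pd i (segAvg h φ) x * f x) := by
      intro x
      rw [← fderiv_segAvg_apply h (hφ.smooth.of_le (by simp)) x, fderiv_apply_eq_sum_pd,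
        Finset.mul_sum]
      refine Finset.sum_congr rfl fun i _ => ?_
      simp only [smul_eq_mul]
      ring
    have b2 : ∀ x, segAvg h φ x * ∑ i, h i * g i x = ∑ i, h i * (segAvg h φ x * g i x) := by
      intro x
      rw [Finset.mul_sum]
      refine Finset.sum_congr rfl fun i _ => ?_
      ring
    simp only [b1, b2]
    rw [integral_finsetSum, integral_finsetSum, ← Finset.sum_neg_distrib]
    · refine Finset.sum_congr rfl fun i _ => ?_
      rw [integral_const_mul, integral_const_mul, hfg i _ hΦ]
      ring
    · intro i _
      exact ((hΦ.memLp 2 _).integrable_mul (hg i)).const_mul _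
    · intro i _
      exact (((hΦ.pd i).memLp 2 _).integrable_mul hf).const_mul _
  rw [e1, e2, neg_neg]
  have hgh : ∀ x, ‖∑ i, h i * g i x‖ₑ ^ 2 ≤ ‖h‖ₑ ^ 2 * ∑ i, ‖g i x‖ₑ ^ 2 := by
    intro x
    have c1 : (∑ i, h i * g i x) ^ 2 ≤ ‖h‖ ^ 2 * ∑ i, ‖g i x‖ ^ 2 := by
      rw [EuclideanSpace.norm_sq_eq]
      simpa using Finset.sum_mul_sq_le_sq_mul_sq Finset.univ (fun i => h i) (fun i => g i x)
    have c2 := ENNReal.ofReal_le_ofReal c1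
    rw [← sq_abs, ENNReal.ofReal_mul (by positivity),
      ENNReal.ofReal_sum_of_nonneg (fun i _ => by positivity)] at c2
    simpa only [← Real.norm_eq_abs, ENNReal.ofReal_pow (norm_nonneg _), ofReal_norm] using c2
  calc ‖∫ x in ballUnit 2, segAvg h φ x * ∑ i, h i * g i x‖ₑ ^ 2
      ≤ (∫⁻ x in ballUnit 2, ‖segAvg h φ x‖ₑ * ‖∑ i, h i * g i x‖ₑ) ^ 2 := by
        gcongr
        refine (enorm_integral_le_lintegral_enorm _).trans_eq ?_
        simp only [enorm_mul]
    _ ≤ (∫⁻ x in ballUnit 2, ‖segAvg h φ x‖ₑ ^ 2) * ∫⁻ x in ballUnit 2, ‖∑ i, h i * g i x‖ₑ ^ 2 :=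
        lintegral_mul_sq_le _ hΦ.continuous.aestronglyMeasurable.enorm
          (AEStronglyMeasurable.enorm (Finset.aestronglyMeasurable_fun_sum _ fun i _ =>
            (hg i).1.const_mul _))
    _ ≤ (∫⁻ x in U, ‖φ x‖ₑ ^ 2) * (‖h‖ₑ ^ 2 * ∫⁻ x in ballUnit 2, ∑ i, ‖g i x‖ₑ ^ 2) := by
        refine mul_le_mul' ?_ ?_
        · refine (setLIntegral_le_lintegral _ _).trans
            ((lintegral_segAvg_sq_le h hφ.continuous.stronglyMeasurable).trans_eq ?_)
          rw [← lintegral_indicator hU.measurableSet]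
          congr 1
          funext x
          by_cases hx : x ∈ U
          · simp [hx]
          · simp [hx, hφ.eq_zero hx]
        · rw [← lintegral_const_mul' _ _ (ENNReal.pow_ne_top enorm_ne_top)]
          exact lintegral_mono hgh
    _ = _ := mul_comm _ _

lemma enorm_add_sq_le (a b : ℝ) : ‖a + b‖ₑ ^ 2 ≤ 2 * ‖a‖ₑ ^ 2 + 2 * ‖b‖ₑ ^ 2 := by
  have h : ‖a + b‖ ^ 2 ≤ 2 * ‖a‖ ^ 2 + 2 * ‖b‖ ^ 2 := by
    simp only [Real.norm_eq_abs, sq_abs]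
    nlinarith [sq_nonneg (a - b)]
  have h2 := ENNReal.ofReal_le_ofReal h
  rwa [ENNReal.ofReal_add (by positivity) (by positivity), ENNReal.ofReal_mul (by positivity),
    ENNReal.ofReal_mul (by positivity), ENNReal.ofReal_pow (by positivity),
    ENNReal.ofReal_pow (by positivity), ENNReal.ofReal_pow (by positivity), ofReal_norm,
    ofReal_norm, ofReal_norm, ENNReal.ofReal_ofNat] at h2

lemma volume_ball_half_le {ε : ℝ} (hε : 0 < ε) (hε1 : ε ≤ 1) {x : Euc 2} (hx : x ∈ ballUnit 2) :
    volume (Metric.ball (0 : Euc 2) (ε / 2)) ≤ volume (ballUnit 2 ∩ Metric.ball x ε) := by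
  rw [← Measure.addHaar_ball_center volume ((1 - ε / 2) • x)]
  apply measure_mono
  have hx1 : ‖x‖ < 1 := by simpa [ballUnit] using hx
  have hx0 := norm_nonneg x
  intro y hy
  rw [Metric.mem_ball, dist_eq_norm] at hy
  constructor
  · rw [ballUnit, mem_ball_zero_iff]
    have e : y = (y - (1 - ε / 2) • x) + (1 - ε / 2) • x := by module
    have : ‖(1 - ε / 2) • x‖ = (1 - ε / 2) * ‖x‖ := by
      rw [norm_smul, Real.norm_of_nonneg (by linarith)]
    rw [e]
    refine (norm_add_le _ _).trans_lt ?_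
    nlinarith
  · rw [Metric.mem_ball, dist_eq_norm]
    have e : y - x = (y - (1 - ε / 2) • x) + (-(ε / 2)) • x := by module
    have : ‖(-(ε / 2)) • x‖ = ε / 2 * ‖x‖ := by
      rw [norm_smul, norm_neg, Real.norm_of_nonneg (by linarith)]
    rw [e]
    refine (norm_add_le _ _).trans_lt ?_
    nlinarith

lemma lintegral_lintegral_sub_sq_le {f : Euc 2 → ℝ} {g : Fin 2 → Euc 2 → ℝ} (hfm : Measurable f)
    (hf : MemLp f 2 (volume.restrict (ballUnit 2)))
    (hg : ∀ i, MemLp (g i) 2 (volume.restrict (ballUnit 2)))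
    (hfg : ∀ i, WD i f (g i)) (ε : ℝ) :
    ∫⁻ x in ballUnit 2, ∫⁻ y in ballUnit 2 ∩ Metric.ball x ε, ‖f x - f y‖ₑ ^ 2 ≤
      volume (Metric.ball (0 : Euc 2) ε) *
        (ENNReal.ofReal ε ^ 2 * ∫⁻ x in ballUnit 2, ∑ i, ‖g i x‖ₑ ^ 2) := by
  set B := ballUnit 2
  have hB : MeasurableSet B := measurableSet_ballUnit
  let T : Set (Euc 2 × Euc 2) := {p | p.1 ∈ B ∧ p.1 - p.2 ∈ B ∧ p.2 ∈ Metric.ball 0 ε}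
  have hT : MeasurableSet T :=
    (measurable_fst hB).inter (((measurable_fst.sub measurable_snd) hB).inter
      (measurable_snd measurableSet_ball))
  let k : Euc 2 × Euc 2 → ℝ≥0∞ := T.indicator fun p => ‖f p.1 - f (p.1 - p.2)‖ₑ ^ 2
  have hk : Measurable k := by
    refine Measurable.indicator ?_ hT
    exact (((hfm.comp measurable_fst).sub
      (hfm.comp (measurable_fst.sub measurable_snd))).enorm).pow_const 2
  have e1 : ∫⁻ x in B, ∫⁻ y in B ∩ Metric.ball x ε, ‖f x - f y‖ₑ ^ 2 = ∫⁻ x, ∫⁻ h, k (x, h) := by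
    rw [← lintegral_indicator hB]
    refine lintegral_congr fun x => ?_
    by_cases hx : x ∈ B
    · rw [indicator_of_mem hx, ← lintegral_indicator (hB.inter measurableSet_ball),
        ← lintegral_sub_left_eq_self _ x]
      refine lintegral_congr fun h => ?_
      by_cases hh : x - h ∈ B ∩ Metric.ball x ε
      · have : (x, h) ∈ T := ⟨hx, hh.1, by simpa [dist_eq_norm] using hh.2⟩
        simp [k, this, hh]
      · have : (x, h) ∉ T := fun h' => hh ⟨h'.2.1, by simpa [dist_eq_norm] using h'.2.2⟩
        simp [k, this, hh]
    · rw [indicator_of_notMem hx]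
      have : ∀ h, (x, h) ∉ T := fun h h' => hx h'.1
      simp [k, this]
  rw [e1, lintegral_lintegral_swap (f := fun x h => k (x, h)) hk.aemeasurable]
  calc ∫⁻ h, ∫⁻ x, k (x, h)
      ≤ ∫⁻ h, (Metric.ball (0 : Euc 2) ε).indicator
          (fun _ => ENNReal.ofReal ε ^ 2 * ∫⁻ x in B, ∑ i, ‖g i x‖ₑ ^ 2) h := by
        refine lintegral_mono fun h => ?_
        by_cases hh : h ∈ Metric.ball (0 : Euc 2) ε
        · rw [indicator_of_mem hh]
          have hm : MeasurableSet (B ∩ {x | x - h ∈ B}) :=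
            hB.inter ((measurable_id.sub_const h) hB)
          have : ∫⁻ x, k (x, h) = ∫⁻ x in B ∩ {x | x - h ∈ B}, ‖f x - f (x - h)‖ₑ ^ 2 := by
            rw [← lintegral_indicator hm]
            refine lintegral_congr fun x => ?_
            by_cases hx : x ∈ B ∩ {x | x - h ∈ B}
            · have : (x, h) ∈ T := ⟨hx.1, hx.2, hh⟩
              simp only [k, indicator_of_mem this, indicator_of_mem hx]
            · have : (x, h) ∉ T := fun h' => hx ⟨h'.1, h'.2.1⟩
              simp only [k, indicator_of_notMem this, indicator_of_notMem hx]
          rw [this]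
          refine (lintegral_translation_sq_le hf hg hfg h).trans ?_
          gcongr
          rw [← ofReal_norm]
          exact ENNReal.ofReal_le_ofReal (mem_ball_zero_iff.1 hh).le
        · rw [indicator_of_notMem hh]
          have : ∀ x, (x, h) ∉ T := fun x h' => hh h'.2.2
          simp [k, this]
    _ = _ := by
        rw [lintegral_indicator measurableSet_ball, setLIntegral_const, mul_comm]

/-- An `L²` function on the disc with `L²` gradient is controlled by its averages at scale `ε`, up
to an error of order `ε`. -/
lemma lintegral_sq_le_average {f : Euc 2 → ℝ} {g : Fin 2 → Euc 2 → ℝ} (hfm : Measurable f)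
    (hf : MemLp f 2 (volume.restrict (ballUnit 2)))
    (hg : ∀ i, MemLp (g i) 2 (volume.restrict (ballUnit 2)))
    (hfg : ∀ i, WD i f (g i)) {ε : ℝ} (hε : 0 < ε) (hε1 : ε ≤ 1) :
    ∫⁻ x in ballUnit 2, ‖f x‖ₑ ^ 2 ≤
      8 * (ENNReal.ofReal ε ^ 2 * ∫⁻ x in ballUnit 2, ∑ i, ‖g i x‖ₑ ^ 2) +
      2 * (volume (Metric.ball (0 : Euc 2) (ε / 2)))⁻¹ ^ 2 *
        ∫⁻ x in ballUnit 2, ‖∫ y in ballUnit 2 ∩ Metric.ball x ε, f y‖ₑ ^ 2 := by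
  set B := ballUnit 2 with hBdef
  set c := volume (Metric.ball (0 : Euc 2) (ε / 2)) with hc
  have hc0 : c ≠ 0 := (Metric.measure_ball_pos volume _ (by positivity)).ne'
  have hct : c ≠ ∞ := measure_ball_lt_top.ne
  have hc4 : volume (Metric.ball (0 : Euc 2) ε) = 4 * c := by
    have h2 : ε = 2 * (ε / 2) := by ring
    conv_lhs => rw [h2]
    rw [Measure.addHaar_ball_mul volume 0 (by norm_num : (0 : ℝ) ≤ 2)]
    simp only [finrank_euclideanSpace, Fintype.card_fin]
    rw [← hc]
    congr 1
    norm_num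
  have hpt : ∀ x ∈ B, ‖f x‖ₑ ^ 2 ≤ 2 * c⁻¹ * (∫⁻ y in B ∩ Metric.ball x ε, ‖f x - f y‖ₑ ^ 2) +
      2 * c⁻¹ ^ 2 * ‖∫ y in B ∩ Metric.ball x ε, f y‖ₑ ^ 2 := by
    intro x hx
    set S := B ∩ Metric.ball x ε
    set m := volume S with hm
    have hcm : c ≤ m := volume_ball_half_le hε hε1 hx
    have hm0 : m ≠ 0 := fun h => hc0 (by simpa [h] using hcm)
    have hmt : m ≠ ∞ := ((measure_mono inter_subset_right).trans_lt
      (measure_ball_lt_top (x := x) (r := ε))).ne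
    have : IsFiniteMeasure (volume.restrict S) := ⟨by
      rw [Measure.restrict_apply_univ]
      exact hmt.lt_top⟩
    have hfS : Integrable f (volume.restrict S) :=
      (hf.mono_measure (Measure.restrict_mono inter_subset_left le_rfl)).integrable one_le_two
    have e : m.toReal * f x = (∫ y in S, (f x - f y)) + ∫ y in S, f y := by
      rw [integral_sub (integrable_const _) hfS, setIntegral_const, sub_add_cancel, smul_eq_mul]
      rfl
    have e2 : (m * ‖f x‖ₑ) ^ 2 ≤ 2 * (m * ∫⁻ y in S, ‖f x - f y‖ₑ ^ 2) +
        2 * ‖∫ y in S, f y‖ₑ ^ 2 := by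
      have : m * ‖f x‖ₑ = ‖m.toReal * f x‖ₑ := by
        rw [enorm_mul, Real.enorm_of_nonneg ENNReal.toReal_nonneg, ENNReal.ofReal_toReal hmt]
      rw [this, e]
      refine (enorm_add_sq_le _ _).trans ?_
      gcongr
      refine (enorm_integral_sq_le _ (hfm.const_sub _).aestronglyMeasurable).trans_eq ?_
      rw [Measure.restrict_apply_univ]
    have hmc : m⁻¹ ≤ c⁻¹ := ENNReal.inv_le_inv.2 hcm
    calc ‖f x‖ₑ ^ 2 = m⁻¹ ^ 2 * (m * ‖f x‖ₑ) ^ 2 := by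
          rw [← mul_pow, ← mul_assoc, ENNReal.inv_mul_cancel hm0 hmt, one_mul]
      _ ≤ m⁻¹ ^ 2 * (2 * (m * ∫⁻ y in S, ‖f x - f y‖ₑ ^ 2) + 2 * ‖∫ y in S, f y‖ₑ ^ 2) := by
          gcongr
      _ = 2 * (m⁻¹ * (m⁻¹ * m)) * (∫⁻ y in S, ‖f x - f y‖ₑ ^ 2) +
          2 * m⁻¹ ^ 2 * ‖∫ y in S, f y‖ₑ ^ 2 := by ring
      _ ≤ _ := by
          rw [ENNReal.inv_mul_cancel hm0 hmt, mul_one]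
          gcongr
  have hmeas : Measurable fun x => ∫⁻ y in B ∩ Metric.ball x ε, ‖f x - f y‖ₑ ^ 2 := by
    have hT : MeasurableSet {p : Euc 2 × Euc 2 | p.2 ∈ B ∩ Metric.ball p.1 ε} :=
      (measurable_snd measurableSet_ballUnit).inter
        (measurableSet_lt (measurable_snd.dist measurable_fst) measurable_const)
    have h1 : Measurable ({p : Euc 2 × Euc 2 | p.2 ∈ B ∩ Metric.ball p.1 ε}.indicator
        fun p => ‖f p.1 - f p.2‖ₑ ^ 2) :=
      ((((hfm.comp measurable_fst).sub (hfm.comp measurable_snd)).enorm).pow_const 2).indicator hT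
    have h2 := h1.lintegral_prod_right' (ν := volume)
    refine (congrArg Measurable (funext fun x => ?_)).mp h2
    rw [← lintegral_indicator (measurableSet_ballUnit.inter measurableSet_ball)]
    rfl
  calc ∫⁻ x in B, ‖f x‖ₑ ^ 2
      ≤ ∫⁻ x in B, (2 * c⁻¹ * (∫⁻ y in B ∩ Metric.ball x ε, ‖f x - f y‖ₑ ^ 2) +
      2 * c⁻¹ ^ 2 * ‖∫ y in B ∩ Metric.ball x ε, f y‖ₑ ^ 2) :=
        setLIntegral_mono' measurableSet_ballUnit hpt
    _ = 2 * c⁻¹ * (∫⁻ x in B, ∫⁻ y in B ∩ Metric.ball x ε, ‖f x - f y‖ₑ ^ 2) +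
        2 * c⁻¹ ^ 2 * ∫⁻ x in B, ‖∫ y in B ∩ Metric.ball x ε, f y‖ₑ ^ 2 := by
        rw [lintegral_add_left (hmeas.const_mul _), lintegral_const_mul _ hmeas,
          lintegral_const_mul' _ _ (by finiteness)]
    _ ≤ 2 * c⁻¹ * (4 * c * (ENNReal.ofReal ε ^ 2 * ∫⁻ x in B, ∑ i, ‖g i x‖ₑ ^ 2)) +
        2 * c⁻¹ ^ 2 * ∫⁻ x in B, ‖∫ y in B ∩ Metric.ball x ε, f y‖ₑ ^ 2 := by
        gcongr
        rw [← hc4]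
        exact lintegral_lintegral_sub_sq_le hfm hf hg hfg ε
    _ = _ := by
        congr 1
        rw [← mul_assoc]
        congr 1
        calc 2 * c⁻¹ * (4 * c) = 2 * 4 * (c⁻¹ * c) := by ring
          _ = 8 := by rw [ENNReal.inv_mul_cancel hc0 hct]; norm_num

/-- Rellich compactness on the disc: weak convergence in `L²` with bounded gradients is strong. -/
lemma tendsto_lintegral_sq_of_weak {f : ℕ → Euc 2 → ℝ} {g : ℕ → Fin 2 → Euc 2 → ℝ}
    (hfm : ∀ k, Measurable (f k)) (hf : ∀ k, MemLp (f k) 2 (volume.restrict (ballUnit 2)))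
    (hg : ∀ k i, MemLp (g k i) 2 (volume.restrict (ballUnit 2)))
    (hfg : ∀ k i, WD i (f k) (g k i)) {M : ℝ≥0∞} (hM : M ≠ ∞)
    (hfM : ∀ k, ∫⁻ x in ballUnit 2, ‖f k x‖ₑ ^ 2 ≤ M)
    (hgM : ∀ k, ∫⁻ x in ballUnit 2, ∑ i, ‖g k i x‖ₑ ^ 2 ≤ M)
    (hw : ∀ ψ, MemLp ψ 2 (volume.restrict (ballUnit 2)) →
      Tendsto (fun k => ∫ x in ballUnit 2, f k x * ψ x) atTop (𝓝 0)) :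
    Tendsto (fun k => ∫⁻ x in ballUnit 2, ‖f k x‖ₑ ^ 2) atTop (𝓝 0) := by
  have havg : ∀ ε : ℝ, Tendsto (fun k => ∫⁻ x in ballUnit 2,
      ‖∫ y in ballUnit 2 ∩ Metric.ball x ε, f k y‖ₑ ^ 2) atTop (𝓝 0) := by
    intro ε
    have heq : ∀ k x, ∫ y in ballUnit 2 ∩ Metric.ball x ε, f k y =
        ∫ y in ballUnit 2, f k y * (Metric.ball x ε).indicator (fun _ => (1 : ℝ)) y := by
      intro k x
      rw [inter_comm, ← Measure.restrict_restrict measurableSet_ball,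
        ← integral_indicator measurableSet_ball]
      congr 1
      funext y
      by_cases hy : y ∈ Metric.ball x ε <;> simp [hy]
    have h0 : (0 : ℝ≥0∞) = ∫⁻ x in ballUnit 2, (0 : ℝ≥0∞) := by simp
    rw [h0]
    refine tendsto_lintegral_of_dominated_convergence
      (fun _ => volume (ballUnit 2) * M) (fun k => ?_) (fun k => ?_) ?_ ?_
    · have hT : MeasurableSet {p : Euc 2 × Euc 2 | p.2 ∈ Metric.ball p.1 ε} :=
        measurableSet_lt (measurable_snd.dist measurable_fst) measurable_const
      have h1 : StronglyMeasurable fun p : Euc 2 × Euc 2 =>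
          {p : Euc 2 × Euc 2 | p.2 ∈ Metric.ball p.1 ε}.indicator (fun p => f k p.2) p :=
        (((hfm k).comp measurable_snd).indicator hT).stronglyMeasurable
      have h2 := h1.integral_prod_right' (ν := volume.restrict (ballUnit 2))
      refine (Measurable.enorm ?_).pow_const 2
      have h3 : (fun x => ∫ y in ballUnit 2 ∩ Metric.ball x ε, f k y) = fun x =>
          ∫ y in ballUnit 2, {p : Euc 2 × Euc 2 | p.2 ∈ Metric.ball p.1 ε}.indicator
            (fun p => f k p.2) (x, y) := by
        funext x
        rw [heq]
        congr 1
        funext y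
        by_cases hy : y ∈ Metric.ball x ε
        · simp [hy, indicator, -Metric.mem_ball]
        · simp [hy, indicator, -Metric.mem_ball]
      rw [h3]
      exact h2.measurable
    · refine Eventually.of_forall fun x => ?_
      refine (enorm_integral_sq_le _ (hfm k).aestronglyMeasurable).trans ?_
      rw [Measure.restrict_apply_univ]
      refine mul_le_mul' (measure_mono inter_subset_left) ?_
      · exact (lintegral_mono_set inter_subset_left).trans (hfM k)
    · rw [lintegral_const]
      have := measure_lt_top (volume.restrict (ballUnit 2)) univ
      have h3 : volume (ballUnit 2) < ∞ := by simpa using this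
      finiteness
    · refine Eventually.of_forall fun x => ?_
      have h1 := hw ((Metric.ball x ε).indicator fun _ => (1 : ℝ))
        ((memLp_const 1).indicator measurableSet_ball)
      simp only [← heq] at h1
      have h2 := (ENNReal.continuous_pow 2).tendsto _ |>.comp (h1.enorm)
      simpa [Function.comp_def] using h2
  rw [ENNReal.tendsto_nhds_zero]
  intro δ hδ
  have hδ2 : 0 < δ / 2 := ENNReal.half_pos hδ.ne'
  obtain ⟨ε, hεle, hε, hε1⟩ : ∃ ε : ℝ, 8 * (ENNReal.ofReal ε ^ 2 * M) ≤ δ / 2 ∧ 0 < ε ∧ ε ≤ 1 := by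
    have h1 : Tendsto (fun ε : ℝ => 8 * (ENNReal.ofReal ε ^ 2 * M)) (𝓝[>] 0) (𝓝 0) := by
      have h2 : Tendsto (fun ε : ℝ => 8 * (ENNReal.ofReal ε ^ 2 * M)) (𝓝 0)
          (𝓝 (8 * (ENNReal.ofReal 0 ^ 2 * M))) := by
        refine ENNReal.Tendsto.const_mul (ENNReal.Tendsto.mul_const ?_ (Or.inr hM))
          (Or.inr (by norm_num))
        exact ((ENNReal.continuous_pow 2).comp ENNReal.continuous_ofReal).tendsto 0
      simp only [ENNReal.ofReal_zero, ne_eq, OfNat.ofNat_ne_zero, not_false_eq_true, zero_pow,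
        zero_mul, mul_zero] at h2
      exact h2.mono_left nhdsWithin_le_nhds
    exact ((ENNReal.tendsto_nhds_zero.1 h1 _ hδ2).and
      (Ioc_mem_nhdsGT (zero_lt_one))).exists
  have hc0 : volume (Metric.ball (0 : Euc 2) (ε / 2)) ≠ 0 :=
    (Metric.measure_ball_pos volume _ (by positivity)).ne'
  have hlim : Tendsto (fun k => 2 * (volume (Metric.ball (0 : Euc 2) (ε / 2)))⁻¹ ^ 2 *
      ∫⁻ x in ballUnit 2, ‖∫ y in ballUnit 2 ∩ Metric.ball x ε, f k y‖ₑ ^ 2) atTop (𝓝 0) := by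
    have := ENNReal.Tendsto.const_mul (a := 2 * (volume (Metric.ball (0 : Euc 2) (ε / 2)))⁻¹ ^ 2)
      (havg ε) (Or.inr (by finiteness))
    simpa using this
  filter_upwards [ENNReal.tendsto_nhds_zero.1 hlim _ hδ2] with k hk
  refine (lintegral_sq_le_average (hfm k) (hf k) (hg k) (hfg k) hε hε1).trans ?_
  rw [← ENNReal.add_halves δ]
  refine add_le_add (le_trans ?_ hεle) hk
  gcongr
  exact hgM k

lemma exists_weak_subseq_hilbert {H : Type*} [NormedAddCommGroup H] [InnerProductSpace ℝ H]
    [CompleteSpace H] [TopologicalSpace.SeparableSpace H] {u : ℕ → H} {R : ℝ}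
    (hu : ∀ k, ‖u k‖ ≤ R) :
    ∃ v : H, ∃ φ : ℕ → ℕ, StrictMono φ ∧
      ∀ w, Tendsto (fun k => inner ℝ (u (φ k)) w) atTop (𝓝 (inner ℝ v w)) := by
  have hs := WeakDual.isSeqCompact_closedBall (𝕜 := ℝ) (E := H) 0 R
  have hmem : ∀ k, StrongDual.toWeakDual (InnerProductSpace.toDual ℝ H (u k)) ∈
      WeakDual.toStrongDual ⁻¹' Metric.closedBall (0 : StrongDual ℝ H) R := by
    intro k
    change InnerProductSpace.toDual ℝ H (u k) ∈ Metric.closedBall (0 : StrongDual ℝ H) R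
    simpa using hu k
  obtain ⟨L, -, φ, hφ, hL⟩ := hs hmem
  refine ⟨(InnerProductSpace.toDual ℝ H).symm (WeakDual.toStrongDual L), φ, hφ, fun w => ?_⟩
  have h := ((WeakDual.eval_continuous w).tendsto L).comp hL
  rw [InnerProductSpace.toDual_symm_apply]
  exact h

lemma exists_weak_subseq {ι α : Type*} [Fintype ι] [MeasurableSpace α]
    [MeasurableSpace.CountablyGenerated α] {μ : Measure α} [SFinite μ] {f : ℕ → ι → α → ℝ}
    (hf : ∀ k i, MemLp (f k i) 2 μ) {M : ℝ≥0∞} (hM : M ≠ ∞)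
    (hfM : ∀ k i, ∫⁻ x, ‖f k i x‖ₑ ^ 2 ∂μ ≤ M) :
    ∃ F : ι → α → ℝ, (∀ i, Measurable (F i)) ∧ (∀ i, MemLp (F i) 2 μ) ∧
      ∃ φ : ℕ → ℕ, StrictMono φ ∧ ∀ i ψ, MemLp ψ 2 μ →
        Tendsto (fun k => ∫ x, f (φ k) i x * ψ x ∂μ) atTop (𝓝 (∫ x, F i x * ψ x ∂μ)) := by
  classical
  let u : ℕ → PiLp 2 (fun _ : ι => Lp ℝ 2 μ) := fun k => WithLp.toLp 2 fun i => (hf k i).toLp _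
  have hu : ∀ k, ‖u k‖ ≤ Real.sqrt (∑ _ : ι, M.toReal) := by
    intro k
    rw [PiLp.norm_eq_of_L2]
    refine Real.sqrt_le_sqrt (Finset.sum_le_sum fun i _ => ?_)
    change ‖(hf k i).toLp _‖ ^ 2 ≤ _
    rw [Lp.norm_toLp, ← ENNReal.toReal_pow, eLpNorm_two_sq]
    exact ENNReal.toReal_mono hM (hfM k i)
  have : Fact ((2 : ℝ≥0∞) ≠ ∞) := ⟨by norm_num⟩
  have : SecondCountableTopology (Lp ℝ 2 μ) := Lp.SecondCountableTopology
  have : TopologicalSpace.SeparableSpace (PiLp 2 (fun _ : ι => Lp ℝ 2 μ)) :=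
    (PiLp.continuousLinearEquiv 2 ℝ
      (fun _ : ι => Lp ℝ 2 μ)).symm.surjective.denseRange.separableSpace
      (PiLp.continuousLinearEquiv 2 ℝ (fun _ : ι => Lp ℝ 2 μ)).symm.continuous
  obtain ⟨v, φ, hφ, hv⟩ := exists_weak_subseq_hilbert hu
  refine ⟨fun i => v i, fun i => (Lp.stronglyMeasurable (v i)).measurable, fun i => Lp.memLp _,
    φ, hφ, fun i ψ hψ => ?_⟩
  have h1 := hv (WithLp.toLp 2 (Pi.single i (hψ.toLp ψ)))
  have key : ∀ w : PiLp 2 (fun _ : ι => Lp ℝ 2 μ),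
      inner ℝ w (WithLp.toLp 2 (Pi.single i (hψ.toLp ψ))) = ∫ x, w i x * ψ x ∂μ := by
    intro w
    rw [PiLp.inner_apply, Finset.sum_eq_single i]
    · simp only [Pi.single_eq_same]
      rw [L2.inner_def]
      apply integral_congr_ae
      filter_upwards [hψ.coeFn_toLp] with x hx
      simp [hx, mul_comm]
    · intro j _ hj
      simp [Pi.single_eq_of_ne hj]
    · simp
  rw [key] at h1
  refine h1.congr fun k => ?_
  rw [key]
  apply integral_congr_ae
  filter_upwards [(hf (φ k) i).coeFn_toLp] with x hx
  change (hf (φ k) i).toLp _ x * ψ x = _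
  rw [hx]

section Lorentz

variable {X E : Type*} [MeasurableSpace X] [NormedAddCommGroup E]
  {μ : Measure X} {f : X → E}

lemma distFn_antitone : Antitone (distFn μ f) :=
  fun _ _ h => measure_mono fun _ hx => lt_of_le_of_lt h hx

lemma rearr_antitone : Antitone (rearr μ f) :=
  fun _ _ h => sInf_le_sInf fun _ ht => le_trans ht (ENNReal.ofReal_le_ofReal h)

lemma exists_lt_distFn {t u : ℝ≥0∞} (h : u < distFn μ f t) : ∃ t' > t, u < distFn μ f t' := by
  have ht : t < ⊤ := by
    by_contra hc
    rw [not_lt, top_le_iff] at hc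
    simp [distFn, hc] at h
  obtain ⟨v, hv, hvt, hlim⟩ := exists_seq_strictAnti_tendsto' ht
  have hU : {x | t < (‖f x‖₊ : ℝ≥0∞)} = ⋃ k, {x | v k < (‖f x‖₊ : ℝ≥0∞)} := by
    ext x
    simp only [mem_ofPred_eq, mem_iUnion]
    constructor
    · intro hx
      exact ((hlim.eventually (gt_mem_nhds hx))).exists
    · rintro ⟨k, hk⟩
      exact (hvt k).1.trans hk
  have hmono : Monotone fun k => {x | v k < (‖f x‖₊ : ℝ≥0∞)} :=
    fun a b hab x hx => lt_of_le_of_lt (hv.antitone hab) hx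
  rw [distFn, hU, hmono.measure_iUnion, lt_iSup_iff] at h
  obtain ⟨k, hk⟩ := h
  exact ⟨v k, (hvt k).1, hk⟩

lemma lt_rearr_iff {s : ℝ} {t : ℝ≥0∞} : t < rearr μ f s ↔ ENNReal.ofReal s < distFn μ f t := by
  constructor
  · intro h
    by_contra hc
    exact absurd h (not_lt.2 (sInf_le (not_lt.1 hc)))
  · intro h
    obtain ⟨t', ht', h'⟩ := exists_lt_distFn h
    refine ht'.trans_le (le_sInf fun u hu => ?_)
    by_contra hc
    exact absurd ((distFn_antitone (not_le.1 hc).le).trans hu) (not_le.2 h')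

lemma lintegral_rearr_sq [IsFiniteMeasure μ] (hf : AEStronglyMeasurable f μ) :
    ∫⁻ s in Ioi (0 : ℝ), rearr μ f s ^ 2 = ∫⁻ x, ‖f x‖ₑ ^ 2 ∂μ := by
  have hr : Measurable (rearr μ f) := rearr_antitone.measurable
  set ν₁ := (volume.restrict (Ioi (0 : ℝ))).map (rearr μ f) with hν₁
  set ν₂ := μ.map fun x => ‖f x‖ₑ with hν₂
  have hm₂ : ∀ t, ν₂ (Ioi t) = distFn μ f t := fun t => by
    rw [hν₂, Measure.map_apply_of_aemeasurable hf.enorm measurableSet_Ioi]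
    rfl
  have hm₁ : ∀ t, ν₁ (Ioi t) = distFn μ f t := fun t => by
    have hd : distFn μ f t ≠ ⊤ := measure_ne_top _ _
    rw [hν₁, Measure.map_apply hr measurableSet_Ioi,
      Measure.restrict_apply (hr measurableSet_Ioi)]
    have : rearr μ f ⁻¹' Ioi t ∩ Ioi 0 = Ioo 0 (distFn μ f t).toReal := by
      ext s
      simp only [mem_inter_iff, mem_preimage, mem_Ioi, mem_Ioo, lt_rearr_iff]
      constructor
      · rintro ⟨h1, h2⟩
        exact ⟨h2, (ENNReal.ofReal_lt_iff_lt_toReal h2.le hd).1 h1⟩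
      · rintro ⟨h1, h2⟩
        exact ⟨(ENNReal.ofReal_lt_iff_lt_toReal h1.le hd).2 h2, h1⟩
    rw [this, Real.volume_Ioo, sub_zero, ENNReal.ofReal_toReal hd]
  have hrestr : ∀ (ν : Measure ℝ≥0∞) t, ν.restrict (Ioi 0) (Ioi t) = ν (Ioi t) := fun ν t => by
    rw [Measure.restrict_apply measurableSet_Ioi,
      inter_eq_left.2 (Ioi_subset_Ioi zero_le)]
  have hfin : IsFiniteMeasure (ν₁.restrict (Ioi 0)) := ⟨by
    rw [Measure.restrict_apply_univ, hm₁]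
    exact measure_lt_top _ _⟩
  have heq : ν₁.restrict (Ioi 0) = ν₂.restrict (Ioi 0) :=
    Measure.ext_of_Iic _ _ fun t => by
      have hfin₂ : IsFiniteMeasure (ν₂.restrict (Ioi 0)) := ⟨by
        rw [Measure.restrict_apply_univ, hm₂]
        exact measure_lt_top _ _⟩
      rw [← compl_Ioi, measure_compl measurableSet_Ioi (measure_ne_top _ _),
        measure_compl measurableSet_Ioi (measure_ne_top _ _), hrestr, hrestr,
        Measure.restrict_apply_univ, Measure.restrict_apply_univ, hm₁, hm₂, hm₁, hm₂]
  have hpos : ∀ ν : Measure ℝ≥0∞, ∫⁻ z, z ^ 2 ∂ν = ∫⁻ z in Ioi 0, z ^ 2 ∂ν := fun ν => by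
    rw [← lintegral_indicator measurableSet_Ioi]
    refine lintegral_congr fun z => ?_
    rcases eq_or_ne z 0 with rfl | hz
    · simp
    · rw [indicator_of_mem (mem_Ioi.2 (pos_iff_ne_zero.2 hz))]
  have hsq : Measurable fun z : ℝ≥0∞ => z ^ 2 := measurable_id.pow_const 2
  rw [← lintegral_map hsq hr, ← lintegral_map' hsq.aemeasurable hf.enorm, hpos, heq, ← hpos]

lemma lorentzNorm_two_two [IsFiniteMeasure μ] (hf : AEStronglyMeasurable f μ) :
    lorentzNorm 2 2 μ f = eLpNorm f 2 μ := by
  have h : lorentzNorm 2 2 μ f ^ 2 = eLpNorm f 2 μ ^ 2 := by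
    rw [eLpNorm_two_sq, ← lintegral_rearr_sq hf, lorentzNorm, if_neg (by norm_num),
      ← ENNReal.rpow_natCast, ← ENNReal.rpow_mul]
    simp only [ENNReal.toReal_ofNat, Nat.cast_ofNat, one_div, ne_eq, OfNat.ofNat_ne_zero,
      not_false_eq_true, inv_mul_cancel₀, ENNReal.rpow_one]
    refine setLIntegral_congr_fun measurableSet_Ioi fun s hs => ?_
    have hs0 : ENNReal.ofReal s ≠ 0 := by simpa using hs
    simp only [ENNReal.toReal_inv, ENNReal.toReal_ofNat]
    rw [ENNReal.mul_rpow_of_nonneg _ _ (by norm_num), ← ENNReal.rpow_mul,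
      ENNReal.ofReal_inv_of_pos hs, mul_right_comm]
    norm_num
    rw [ENNReal.mul_inv_cancel hs0 ENNReal.ofReal_ne_top, one_mul]
  exact (ENNReal.pow_right_strictMono two_ne_zero).injective h

end Lorentz

lemma memLp_continuous_mul {ψ f : Euc 2 → ℝ} (hψ : Continuous ψ)
    (hf : MemLp f 2 (volume.restrict (ballUnit 2))) :
    MemLp (fun x => ψ x * f x) 2 (volume.restrict (ballUnit 2)) := by
  obtain ⟨C, hC⟩ := (isCompact_closedBall (0 : Euc 2) 1).exists_bound_of_continuousOn
    hψ.continuousOn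
  refine hf.of_le_mul (c := C) (hψ.aestronglyMeasurable.mul hf.1) ?_
  refine (ae_restrict_iff' measurableSet_ballUnit).2 (Eventually.of_forall fun x hx => ?_)
  rw [norm_mul]
  gcongr
  exact hC x (Metric.ball_subset_closedBall hx)

lemma memLp_bounded_mul {α : Type*} [MeasurableSpace α] {μ : Measure α} {u f : α → ℝ}
    (hu : Measurable u) (hu1 : ∀ x, |u x| ≤ 1) (hf : MemLp f 2 μ) :
    MemLp (fun x => u x * f x) 2 μ := by
  refine hf.of_le (hu.aestronglyMeasurable.mul hf.1) (Eventually.of_forall fun x => ?_)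
  rw [norm_mul]
  exact mul_le_of_le_one_left (norm_nonneg _) (hu1 x)

lemma memLp_of_bounded {u : Euc 2 → ℝ} (hu : Measurable u) (hu1 : ∀ x, |u x| ≤ 1) :
    MemLp u 2 (volume.restrict (ballUnit 2)) := by
  simpa using memLp_bounded_mul hu hu1 (memLp_const (1 : ℝ))

lemma WD.congr_ae {i : Fin 2} {f g f' g' : Euc 2 → ℝ} (h : WD i f g)
    (hf : f =ᵐ[volume.restrict (ballUnit 2)] f') (hg : g =ᵐ[volume.restrict (ballUnit 2)] g') :
    WD i f' g' := by
  intro φ hφ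
  rw [← integral_congr_ae (hf.mono fun x hx => congrArg (pd i φ x * ·) hx),
    ← integral_congr_ae (hg.mono fun x hx => congrArg (φ x * ·) hx)]
  exact h φ hφ

lemma integrable_test_mul {φ f : Euc 2 → ℝ} (hφ : IsTestFun (ballUnit 2) φ)
    (hf : MemLp f 2 (volume.restrict (ballUnit 2))) :
    Integrable (fun x => φ x * f x) (volume.restrict (ballUnit 2)) :=
  integrable_mul_of_memLp (hφ.memLp 2 _) hf

lemma WD.sub {i : Fin 2} {f g f' g' : Euc 2 → ℝ} (h : WD i f g) (h' : WD i f' g')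
    (hf : MemLp f 2 (volume.restrict (ballUnit 2)))
    (hg : MemLp g 2 (volume.restrict (ballUnit 2)))
    (hf' : MemLp f' 2 (volume.restrict (ballUnit 2)))
    (hg' : MemLp g' 2 (volume.restrict (ballUnit 2))) :
    WD i (fun x => f x - f' x) (fun x => g x - g' x) := by
  intro φ hφ
  simp only [mul_sub]
  rw [integral_sub (integrable_test_mul (hφ.pd i) hf) (integrable_test_mul (hφ.pd i) hf'),
    integral_sub (integrable_test_mul hφ hg) (integrable_test_mul hφ hg'), h φ hφ, h' φ hφ]
  ring

lemma WD.sum {ι : Type*} {s : Finset ι} {i : Fin 2} {f g : ι → Euc 2 → ℝ}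
    (h : ∀ j ∈ s, WD i (f j) (g j))
    (hf : ∀ j ∈ s, MemLp (f j) 2 (volume.restrict (ballUnit 2)))
    (hg : ∀ j ∈ s, MemLp (g j) 2 (volume.restrict (ballUnit 2))) :
    WD i (fun x => ∑ j ∈ s, f j x) (fun x => ∑ j ∈ s, g j x) := by
  intro φ hφ
  simp only [Finset.mul_sum]
  rw [integral_finsetSum _ fun j hj => integrable_test_mul (hφ.pd i) (hf j hj),
    integral_finsetSum _ fun j hj => integrable_test_mul hφ (hg j hj), ← Finset.sum_neg_distrib]
  exact Finset.sum_congr rfl fun j hj => h j hj φ hφ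

lemma pd_mul {ψ φ : Euc 2 → ℝ} (hψ : ContDiff ℝ (⊤ : ℕ∞) ψ) (hφ : ContDiff ℝ (⊤ : ℕ∞) φ)
    (i : Fin 2) (x : Euc 2) :
    pd i (fun y => ψ y * φ y) x = ψ x * pd i φ x + pd i ψ x * φ x := by
  have h := (hψ.differentiable (by simp) x).hasFDerivAt.mul
    (hφ.differentiable (by simp) x).hasFDerivAt
  change fderiv ℝ (ψ * φ) x _ = _
  rw [h.fderiv]
  simp [pd, mul_comm]

lemma WD.smooth_mul {i : Fin 2} {ψ f g : Euc 2 → ℝ} (hψ : ContDiff ℝ (⊤ : ℕ∞) ψ) (h : WD i f g)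
    (hf : MemLp f 2 (volume.restrict (ballUnit 2)))
    (hg : MemLp g 2 (volume.restrict (ballUnit 2))) :
    WD i (fun x => ψ x * f x) (fun x => pd i ψ x * f x + ψ x * g x) := by
  intro φ hφ
  have hpd : Continuous (pd i ψ) := (hψ.continuous_fderiv (by simp)).clm_apply continuous_const
  have h1 := h _ (hφ.mul_left hψ)
  have e1 : ∀ x, pd i φ x * (ψ x * f x) =
      pd i (fun y => ψ y * φ y) x * f x - φ x * (pd i ψ x * f x) := by
    intro x
    rw [pd_mul hψ hφ.smooth]
    ring
  have e2 : ∀ x, φ x * (pd i ψ x * f x + ψ x * g x) =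
      φ x * (pd i ψ x * f x) + ψ x * φ x * g x := fun x => by ring
  simp only [e1, e2]
  rw [integral_sub (integrable_test_mul ((hφ.mul_left hψ).pd i) hf)
    (integrable_test_mul hφ (memLp_continuous_mul hpd hf)),
    integral_add (integrable_test_mul hφ (memLp_continuous_mul hpd hf))
    (integrable_test_mul (hφ.mul_left hψ) hg), h1]
  ring

lemma setIntegral_test {φ : Euc 2 → ℝ} (hφ : IsTestFun (ballUnit 2) φ) (f : Euc 2 → ℝ) :
    ∫ x in ballUnit 2, φ x * f x = ∫ x, φ x * f x :=
  setIntegral_eq_integral_of_forall_compl_eq_zero fun x hx => by simp [hφ.eq_zero hx]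

lemma WD.const (i : Fin 2) (c : ℝ) : WD i (fun _ => c) (fun _ => 0) := by
  intro φ hφ
  rw [setIntegral_test (hφ.pd i)]
  have h1 : Integrable (fun x => (fderiv ℝ φ x) (EuclideanSpace.single i 1) * c) :=
    ((memLp_one_iff_integrable.1 ((hφ.pd i).memLp 1 volume)).mul_const c)
  have h2 : Integrable (fun x => φ x * c) :=
    ((memLp_one_iff_integrable.1 (hφ.memLp 1 volume)).mul_const c)
  have h3 := integral_mul_fderiv_eq_neg_fderiv_mul_of_integrable (μ := volume) (f := φ)
    (g := fun _ : Euc 2 => c) (v := EuclideanSpace.single i 1) h1 (by simp) h2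
    (fun x _ => hφ.smooth.differentiable (by simp) x) (fun x _ => by simp)
  simp only [fderiv_fun_const, Pi.zero_apply, zero_apply, mul_zero, integral_zero] at h3 ⊢
  simpa [pd] using h3.symm

/-- Square integrability on the unit disc. -/
abbrev MemL2 (f : Euc 2 → ℝ) : Prop := MemLp f 2 (volume.restrict (ballUnit 2))

lemma lintegral_enorm_sq_eq_ofReal {α : Type*} [MeasurableSpace α] {μ : Measure α} {f : α → ℝ}
    (hf : MemLp f 2 μ) : ∫⁻ x, ‖f x‖ₑ ^ 2 ∂μ = ENNReal.ofReal (∫ x, f x ^ 2 ∂μ) := by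
  rw [ofReal_integral_eq_lintegral_ofReal hf.integrable_sq
    (Eventually.of_forall fun x => sq_nonneg (f x))]
  refine lintegral_congr fun x => ?_
  rw [← ofReal_norm, ← ENNReal.ofReal_pow (norm_nonneg _), Real.norm_eq_abs, sq_abs]

lemma tendsto_integral_mul_of_weak_strong {f g : ℕ → Euc 2 → ℝ} {F G : Euc 2 → ℝ}
    (hf : ∀ k, MemL2 (f k)) (hg : ∀ k, MemL2 (g k)) (hG : MemL2 G) {M : ℝ≥0∞} (hM : M ≠ ∞)
    (hfM : ∀ k, ∫⁻ x in ballUnit 2, ‖f k x‖ₑ ^ 2 ≤ M)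
    (hw : ∀ ψ, MemL2 ψ → Tendsto (fun k => ∫ x in ballUnit 2, f k x * ψ x) atTop
      (𝓝 (∫ x in ballUnit 2, F x * ψ x)))
    (hs : Tendsto (fun k => ∫⁻ x in ballUnit 2, ‖g k x - G x‖ₑ ^ 2) atTop (𝓝 0)) :
    Tendsto (fun k => ∫ x in ballUnit 2, f k x * g k x) atTop
      (𝓝 (∫ x in ballUnit 2, F x * G x)) := by
  have h1 : Tendsto (fun k => ∫ x in ballUnit 2, f k x * (g k x - G x)) atTop (𝓝 0) := by
    have h2 : Tendsto (fun k => ‖∫ x in ballUnit 2, f k x * (g k x - G x)‖ₑ ^ 2) atTop (𝓝 0) := by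
      have h3 : Tendsto (fun k => M * ∫⁻ x in ballUnit 2, ‖g k x - G x‖ₑ ^ 2) atTop (𝓝 0) := by
        simpa using ENNReal.Tendsto.const_mul hs (Or.inr hM)
      refine tendsto_of_tendsto_of_tendsto_of_le_of_le tendsto_const_nhds h3
        (fun k => zero_le) fun k => ?_
      calc ‖∫ x in ballUnit 2, f k x * (g k x - G x)‖ₑ ^ 2
          ≤ (∫⁻ x in ballUnit 2, ‖f k x‖ₑ * ‖g k x - G x‖ₑ) ^ 2 := by
            gcongr
            refine (enorm_integral_le_lintegral_enorm _).trans_eq ?_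
            simp only [enorm_mul]
        _ ≤ _ := lintegral_mul_sq_le _ (hf k).1.enorm ((hg k).1.sub hG.1).enorm
        _ ≤ _ := by
            gcongr
            exact hfM k
    have h4 := (ENNReal.continuous_rpow_const (y := (2 : ℝ)⁻¹)).tendsto 0 |>.comp h2
    rw [tendsto_zero_iff_enorm_tendsto_zero]
    refine (by simpa using h4 : Tendsto _ _ _).congr fun k => ?_
    simp only [Function.comp]
    rw [← ENNReal.rpow_natCast, ← ENNReal.rpow_mul]
    simp
  have h5 := (hw G hG).add h1
  rw [add_zero] at h5
  refine h5.congr fun k => ?_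
  have hi : Integrable (fun x => f k x * (g k x - G x)) (volume.restrict (ballUnit 2)) :=
    integrable_mul_of_memLp (hf k) ((hg k).sub hG)
  rw [← integral_add (integrable_mul_of_memLp (hf k) hG) hi]
  congr 1
  funext x
  ring

section Gauge

variable {n : ℕ}

lemma IsSO.abs_apply_le_one {A : Mat n} (hA : IsSO A) (a b : Fin n) : |A a b| ≤ 1 := by
  have h : (A.transpose * A) b b = 1 := by rw [hA.1]; simp
  rw [Matrix.mul_apply] at h
  have h2 : A a b * A a b ≤ 1 := by
    rw [← h]
    exact Finset.single_le_sum (f := fun c => A.transpose b c * A c b)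
      (fun c _ => mul_self_nonneg (A c b)) (Finset.mem_univ a)
  rw [abs_le]
  constructor <;> nlinarith

lemma isSO_one : IsSO (1 : Mat n) := by simp [IsSO]

/-- The gauge transformations `P` for which `dP = X P + P Ω` with `X` an `L²` antisymmetric
one-form. -/
structure IsAdmissible (Ω : Euc 2 → Fin 2 → Mat n) (P : Euc 2 → Mat n)
    (X : Euc 2 → Fin 2 → Mat n) : Prop where
  isSO : ∀ x, IsSO (P x)
  measurable : ∀ a b, Measurable fun x => P x a b
  antisymm : ∀ x i, IsAntisym (X x i)
  memLp : ∀ i a b, MemL2 fun x => X x i a b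
  wd : ∀ i a b, WD i (fun x => P x a b) fun x => (X x i * P x + P x * Ω x i) a b

/-- The Dirichlet type energy of a matrix-valued one-form. -/
def formEnergy (X : Euc 2 → Fin 2 → Mat n) : ℝ :=
  ∑ i, ∑ a, ∑ b, ∫ x in ballUnit 2, X x i a b ^ 2

lemma formEnergy_nonneg (X : Euc 2 → Fin 2 → Mat n) : 0 ≤ formEnergy X :=
  Finset.sum_nonneg fun _ _ => Finset.sum_nonneg fun _ _ => Finset.sum_nonneg fun _ _ =>
    integral_nonneg fun _ => sq_nonneg _

lemma integral_sq_le_formEnergy (X : Euc 2 → Fin 2 → Mat n) (i : Fin 2) (a b : Fin n) :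
    ∫ x in ballUnit 2, X x i a b ^ 2 ≤ formEnergy X := by
  have h0 : ∀ i a b, 0 ≤ ∫ x in ballUnit 2, X x i a b ^ 2 :=
    fun _ _ _ => integral_nonneg fun _ => sq_nonneg _
  refine (Finset.single_le_sum (f := fun b => ∫ x in ballUnit 2, X x i a b ^ 2)
    (fun _ _ => h0 _ _ _) (Finset.mem_univ b)).trans ?_
  refine (Finset.single_le_sum (f := fun a => ∑ b, ∫ x in ballUnit 2, X x i a b ^ 2)
    (fun _ _ => Finset.sum_nonneg fun _ _ => h0 _ _ _) (Finset.mem_univ a)).trans ?_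
  exact Finset.single_le_sum (f := fun i => ∑ a, ∑ b, ∫ x in ballUnit 2, X x i a b ^ 2)
    (fun _ _ => Finset.sum_nonneg fun _ _ => Finset.sum_nonneg fun _ _ => h0 _ _ _)
    (Finset.mem_univ i)

namespace IsAdmissible

variable {Ω X : Euc 2 → Fin 2 → Mat n} {P : Euc 2 → Mat n}

lemma memL2_apply (h : IsAdmissible Ω P X) (a b : Fin n) : MemL2 fun x => P x a b :=
  memLp_of_bounded (h.measurable a b) fun x => (h.isSO x).abs_apply_le_one a b

lemma memL2_left (h : IsAdmissible Ω P X) (i : Fin 2) (a b c d : Fin n) :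
    MemL2 fun x => X x i a b * P x c d := by
  simpa only [mul_comm] using memLp_bounded_mul (h.measurable c d)
    (fun x => (h.isSO x).abs_apply_le_one c d) (h.memLp i a b)

lemma memL2_right (h : IsAdmissible Ω P X) (hΩ : ∀ i a b, MemL2 fun x => Ω x i a b) (i : Fin 2)
    (a b c d : Fin n) : MemL2 fun x => P x a b * Ω x i c d :=
  memLp_bounded_mul (h.measurable a b) (fun x => (h.isSO x).abs_apply_le_one a b) (hΩ i c d)

lemma memL2_grad (h : IsAdmissible Ω P X) (hΩ : ∀ i a b, MemL2 fun x => Ω x i a b) (i : Fin 2)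
    (a b : Fin n) : MemL2 fun x => (X x i * P x + P x * Ω x i) a b := by
  simp only [Matrix.add_apply, Matrix.mul_apply]
  exact (memLp_finsetSum _ fun c _ => h.memL2_left i a c c b).add
    (memLp_finsetSum _ fun c _ => h.memL2_right hΩ i a c c b)

lemma integral_grad_sq_le (h : IsAdmissible Ω P X) (hΩ : ∀ i a b, MemL2 fun x => Ω x i a b)
    (i : Fin 2) (a b : Fin n) :
    ∫ x in ballUnit 2, (X x i * P x + P x * Ω x i) a b ^ 2 ≤
      n * (∑ _c : Fin n, (2 * formEnergy X + 2 * formEnergy Ω)) := by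
  have hpt : ∀ x, (X x i * P x + P x * Ω x i) a b ^ 2 ≤
      n * ∑ c, (2 * X x i a c ^ 2 + 2 * Ω x i c b ^ 2) := by
    intro x
    have e : (X x i * P x + P x * Ω x i) a b =
        ∑ c, (X x i a c * P x c b + P x a c * Ω x i c b) := by
      rw [Matrix.add_apply, Matrix.mul_apply, Matrix.mul_apply, Finset.sum_add_distrib]
    rw [e]
    refine (sq_sum_le_card_mul_sum_sq).trans ?_
    rw [Finset.card_univ, Fintype.card_fin]
    gcongr with c
    have h1 := sq_le_one_iff_abs_le_one _ |>.2 ((h.isSO x).abs_apply_le_one c b)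
    have h2 := sq_le_one_iff_abs_le_one _ |>.2 ((h.isSO x).abs_apply_le_one a c)
    nlinarith [sq_nonneg (X x i a c * P x c b - P x a c * Ω x i c b),
      mul_nonneg (sq_nonneg (X x i a c)) (sub_nonneg.2 h1),
      mul_nonneg (sq_nonneg (Ω x i c b)) (sub_nonneg.2 h2)]
  have hX := fun a b => (h.memLp i a b).integrable_sq.const_mul 2
  have hO := fun a b => (hΩ i a b).integrable_sq.const_mul 2
  have hXO : ∀ c, Integrable (fun x => 2 * X x i a c ^ 2 + 2 * Ω x i c b ^ 2)
      (volume.restrict (ballUnit 2)) := fun c => (hX a c).add (hO c b)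
  refine (integral_mono (h.memL2_grad hΩ i a b).integrable_sq
    ((integrable_finsetSum _ fun c _ => hXO c).const_mul _) hpt).trans ?_
  rw [integral_const_mul, integral_finsetSum _ fun c _ => hXO c]
  gcongr with c
  rw [integral_add (hX a c) (hO c b), integral_const_mul, integral_const_mul]
  gcongr
  · exact integral_sq_le_formEnergy X i a c
  · exact integral_sq_le_formEnergy Ω i c b

end IsAdmissible

end Gauge

lemma WD.of_tendsto {i : Fin 2} {f g : ℕ → Euc 2 → ℝ} {F G : Euc 2 → ℝ}
    (h : ∀ k, WD i (f k) (g k))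
    (hf : ∀ ψ, MemL2 ψ → Tendsto (fun k => ∫ x in ballUnit 2, f k x * ψ x) atTop
      (𝓝 (∫ x in ballUnit 2, F x * ψ x)))
    (hg : ∀ ψ, MemL2 ψ → Tendsto (fun k => ∫ x in ballUnit 2, g k x * ψ x) atTop
      (𝓝 (∫ x in ballUnit 2, G x * ψ x))) : WD i F G := by
  intro φ hφ
  have h1 := hf _ ((hφ.pd i).memLp 2 _)
  have h2 := (hg _ (hφ.memLp 2 _)).neg
  simp only [mul_comm _ (pd i φ _), mul_comm _ (φ _)] at h1 h2
  refine tendsto_nhds_unique h1 (h2.congr fun k => ?_)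
  exact (h k φ hφ).symm

lemma tendsto_lintegral_sub_sq {f : ℕ → Euc 2 → ℝ} {g : ℕ → Fin 2 → Euc 2 → ℝ} {F : Euc 2 → ℝ}
    {G : Fin 2 → Euc 2 → ℝ} (hfm : ∀ k, Measurable (f k)) (hFm : Measurable F)
    (hf : ∀ k, MemL2 (f k)) (hF : MemL2 F) (hg : ∀ k i, MemL2 (g k i)) (hG : ∀ i, MemL2 (G i))
    (h : ∀ k i, WD i (f k) (g k i)) {M : ℝ≥0∞} (hM : M ≠ ∞)
    (hfM : ∀ k, ∫⁻ x in ballUnit 2, ‖f k x‖ₑ ^ 2 ≤ M)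
    (hgM : ∀ k i, ∫⁻ x in ballUnit 2, ‖g k i x‖ₑ ^ 2 ≤ M)
    (hwf : ∀ ψ, MemL2 ψ → Tendsto (fun k => ∫ x in ballUnit 2, f k x * ψ x) atTop
      (𝓝 (∫ x in ballUnit 2, F x * ψ x)))
    (hwg : ∀ i ψ, MemL2 ψ → Tendsto (fun k => ∫ x in ballUnit 2, g k i x * ψ x) atTop
      (𝓝 (∫ x in ballUnit 2, G i x * ψ x))) :
    Tendsto (fun k => ∫⁻ x in ballUnit 2, ‖f k x - F x‖ₑ ^ 2) atTop (𝓝 0) := by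
  have hFG : ∀ i, WD i F (G i) := fun i => WD.of_tendsto (h · i) hwf (hwg i)
  have hsub : ∀ {u v : Euc 2 → ℝ}, MemL2 u → MemL2 v →
      ∫⁻ x in ballUnit 2, ‖u x - v x‖ₑ ^ 2 ≤
        2 * (∫⁻ x in ballUnit 2, ‖u x‖ₑ ^ 2) + 2 * ∫⁻ x in ballUnit 2, ‖v x‖ₑ ^ 2 := by
    intro u v hu hv
    rw [← lintegral_const_mul'' _ (hu.1.enorm.pow_const 2),
      ← lintegral_const_mul'' _ (hv.1.enorm.pow_const 2),
      ← lintegral_add_left' ((hu.1.enorm.pow_const 2).const_mul 2)]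
    refine lintegral_mono fun x => ?_
    have := enorm_add_sq_le (u x) (-v x)
    rwa [enorm_neg, ← sub_eq_add_neg] at this
  have hfin : ∀ {u : Euc 2 → ℝ}, MemL2 u → ∫⁻ x in ballUnit 2, ‖u x‖ₑ ^ 2 ≠ ∞ := by
    intro u hu
    rw [lintegral_enorm_sq_eq_ofReal hu]
    exact ENNReal.ofReal_ne_top
  have hne : ∀ {u : Euc 2 → ℝ}, MemL2 u → 2 * M + 2 * ∫⁻ x in ballUnit 2, ‖u x‖ₑ ^ 2 ≠ ∞ :=
    fun hu => ENNReal.add_ne_top.2 ⟨ENNReal.mul_ne_top (by simp) hM,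
      ENNReal.mul_ne_top (by simp) (hfin hu)⟩
  set A := 2 * M + 2 * ∫⁻ x in ballUnit 2, ‖F x‖ₑ ^ 2 with hA
  set A' : Fin 2 → ℝ≥0∞ := fun i => 2 * M + 2 * ∫⁻ x in ballUnit 2, ‖G i x‖ₑ ^ 2 with hA'
  refine tendsto_lintegral_sq_of_weak (f := fun k x => f k x - F x)
    (g := fun k i x => g k i x - G i x) (M := A + ∑ i, A' i) (fun k => (hfm k).sub hFm)
    (fun k => (hf k).sub hF) (fun k i => (hg k i).sub (hG i))
    (fun k i => (h k i).sub (hFG i) (hf k) (hg k i) hF (hG i)) ?_ ?_ ?_ ?_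
  · exact ENNReal.add_ne_top.2 ⟨hne hF, ENNReal.sum_ne_top.2 fun i _ => hne (hG i)⟩
  · intro k
    refine (hsub (hf k) hF).trans (le_trans ?_ le_self_add)
    rw [hA]
    gcongr
    exact hfM k
  · intro k
    have hm : ∀ i, AEMeasurable (fun x => ‖g k i x - G i x‖ₑ ^ 2)
        (volume.restrict (ballUnit 2)) := fun i => ((hg k i).sub (hG i)).1.enorm.pow_const 2
    rw [lintegral_finsetSum' _ fun i _ => hm i]
    refine le_trans (Finset.sum_le_sum fun i _ => ?_) le_add_self
    refine (hsub (hg k i) (hG i)).trans ?_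
    simp only [hA']
    gcongr
    exact hgM k i
  · intro ψ hψ
    have := (hwf ψ hψ).sub_const (∫ x in ballUnit 2, F x * ψ x)
    rw [sub_self] at this
    refine this.congr fun k => ?_
    simp only [sub_mul]
    rw [integral_sub (integrable_mul_of_memLp (hf k) hψ) (integrable_mul_of_memLp hF hψ)]

lemma tendsto_integral_test_mul {φ : Euc 2 → ℝ} (hφ : IsTestFun (ballUnit 2) φ)
    {f g : ℕ → Euc 2 → ℝ} {F G : Euc 2 → ℝ}
    (hf : ∀ k, MemL2 (f k)) (hg : ∀ k, MemL2 (g k)) (hG : MemL2 G) {M : ℝ≥0∞} (hM : M ≠ ∞)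
    (hfM : ∀ k, ∫⁻ x in ballUnit 2, ‖f k x‖ₑ ^ 2 ≤ M)
    (hw : ∀ ψ, MemL2 ψ → Tendsto (fun k => ∫ x in ballUnit 2, f k x * ψ x) atTop
      (𝓝 (∫ x in ballUnit 2, F x * ψ x)))
    (hs : Tendsto (fun k => ∫⁻ x in ballUnit 2, ‖g k x - G x‖ₑ ^ 2) atTop (𝓝 0)) :
    Tendsto (fun k => ∫ x in ballUnit 2, φ x * (f k x * g k x)) atTop
      (𝓝 (∫ x in ballUnit 2, φ x * (F x * G x))) := by
  obtain ⟨C, hC⟩ := hφ.continuous.bounded_above_of_compact_support hφ.supp_compact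
  have h1 : Tendsto (fun k => ∫⁻ x in ballUnit 2, ‖φ x * g k x - φ x * G x‖ₑ ^ 2) atTop
      (𝓝 0) := by
    have h3 : Tendsto (fun k => ENNReal.ofReal C ^ 2 * ∫⁻ x in ballUnit 2, ‖g k x - G x‖ₑ ^ 2)
        atTop (𝓝 0) := by
      simpa using ENNReal.Tendsto.const_mul hs (Or.inr (by finiteness))
    refine tendsto_of_tendsto_of_tendsto_of_le_of_le tendsto_const_nhds h3
      (fun k => zero_le) fun k => ?_
    rw [← lintegral_const_mul' _ _ (by finiteness)]
    refine lintegral_mono fun x => ?_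
    rw [← mul_sub, enorm_mul, mul_pow]
    gcongr
    rw [← ofReal_norm]
    exact ENNReal.ofReal_le_ofReal (hC x)
  have := tendsto_integral_mul_of_weak_strong hf
    (fun k => memLp_continuous_mul hφ.continuous (hg k))
    (memLp_continuous_mul hφ.continuous hG) hM hfM hw h1
  simpa only [mul_left_comm (φ _)] using this

lemma exists_subseq_ae_tendsto {ι : Type*} [Fintype ι] {f : ℕ → ι → Euc 2 → ℝ} {F : ι → Euc 2 → ℝ}
    (hf : ∀ k j, Measurable (f k j)) (hF : ∀ j, Measurable (F j))
    (hs : ∀ j, Tendsto (fun k => ∫⁻ x in ballUnit 2, ‖f k j x - F j x‖ₑ ^ 2) atTop (𝓝 0)) :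
    ∃ ns : ℕ → ℕ, StrictMono ns ∧ ∀ᵐ x ∂volume.restrict (ballUnit 2), ∀ j,
      Tendsto (fun k => f (ns k) j x) atTop (𝓝 (F j x)) := by
  have hm : ∀ k, Measurable fun x => ∑ j, (f k j x - F j x) ^ 2 := fun k =>
    Finset.measurable_fun_sum _ fun j _ => ((hf k j).sub (hF j)).pow_const 2
  have h1 : TendstoInMeasure (volume.restrict (ballUnit 2))
      (fun k x => ∑ j, (f k j x - F j x) ^ 2) atTop fun _ => 0 := by
    refine tendstoInMeasure_of_tendsto_eLpNorm (p := 1) one_ne_zero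
      (fun k => (hm k).aestronglyMeasurable) aestronglyMeasurable_const ?_
    have h2 := tendsto_finsetSum Finset.univ fun j _ => hs j
    rw [Finset.sum_const_zero] at h2
    refine tendsto_of_tendsto_of_tendsto_of_le_of_le tendsto_const_nhds h2
      (fun k => zero_le) fun k => ?_
    have hm' : ∀ j, Measurable fun x => ‖f k j x - F j x‖ₑ ^ 2 :=
      fun j => ((hf k j).sub (hF j)).enorm.pow_const 2
    rw [eLpNorm_one_eq_lintegral_enorm, ← lintegral_finsetSum _ fun j _ => hm' j]
    refine lintegral_mono fun x => ?_
    simp only [Pi.sub_apply, sub_zero]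
    refine (enorm_sum_le _ _).trans (Finset.sum_le_sum fun j _ => ?_)
    rw [enorm_pow]
  obtain ⟨ns, hns, hae⟩ := h1.exists_seq_tendsto_ae
  refine ⟨ns, hns, hae.mono fun x hx j => ?_⟩
  rw [tendsto_iff_norm_sub_tendsto_zero]
  have h3 := (Real.continuous_sqrt.tendsto 0).comp hx
  rw [Real.sqrt_zero] at h3
  refine squeeze_zero (fun _ => norm_nonneg _) (fun k => ?_) h3
  refine Real.le_sqrt_of_sq_le ?_
  rw [Real.norm_eq_abs, sq_abs]
  exact Finset.single_le_sum (f := fun j => (f (ns k) j x - F j x) ^ 2)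
    (fun _ _ => sq_nonneg _) (Finset.mem_univ j)

lemma isClosed_setOf_isSO (n : ℕ) :
    IsClosed {A : Fin n → Fin n → ℝ | IsSO (Matrix.of A : Mat n)} := by
  have h : {A : Fin n → Fin n → ℝ | IsSO (Matrix.of A : Mat n)} =
      {A | ∀ a b, ∑ c, A c a * A c b = (1 : Mat n) a b} ∩
        {A | ∑ σ : Equiv.Perm (Fin n), Equiv.Perm.sign σ • ∏ i, A (σ i) i = 1} := by
    ext A
    simp only [IsSO, Set.mem_ofPred_eq, Set.mem_inter_iff, Matrix.det_apply, ← Matrix.ext_iff,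
      Matrix.mul_apply, Matrix.transpose_apply, Matrix.of_apply]
  rw [h]
  refine IsClosed.inter ?_ (isClosed_eq (by fun_prop) continuous_const)
  simp only [Set.ofPred_forall]
  exact isClosed_iInter fun a => isClosed_iInter fun b =>
    isClosed_eq (by fun_prop) continuous_const

section Compactness

variable {n : ℕ} {Ω : Euc 2 → Fin 2 → Mat n}

open Classical in
lemma IsAdmissible.of_limit (hΩ : ∀ i a b, MemL2 fun x => Ω x i a b) {P : ℕ → Euc 2 → Mat n}
    {X : ℕ → Euc 2 → Fin 2 → Mat n} (h : ∀ k, IsAdmissible Ω (P k) (X k)) {M : ℝ≥0∞} (hM : M ≠ ∞)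
    (hXM : ∀ k i a b, ∫⁻ x in ballUnit 2, ‖X k x i a b‖ₑ ^ 2 ≤ M)
    {p : Fin n → Fin n → Euc 2 → ℝ} (hpm : ∀ a b, Measurable (p a b))
    (hs : ∀ a b, Tendsto (fun k => ∫⁻ x in ballUnit 2, ‖P k x a b - p a b x‖ₑ ^ 2) atTop (𝓝 0))
    (hwp : ∀ a b ψ, MemL2 ψ → Tendsto (fun k => ∫ x in ballUnit 2, P k x a b * ψ x) atTop
      (𝓝 (∫ x in ballUnit 2, p a b x * ψ x)))
    {Y : Euc 2 → Fin 2 → Mat n} (hYa : ∀ x i, IsAntisym (Y x i))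
    (hY : ∀ i a b, MemL2 fun x => Y x i a b)
    (hwY : ∀ i a b ψ, MemL2 ψ → Tendsto (fun k => ∫ x in ballUnit 2, X k x i a b * ψ x) atTop
      (𝓝 (∫ x in ballUnit 2, Y x i a b * ψ x))) :
    ∃ Q, IsAdmissible Ω Q Y := by
  let S : Set (Euc 2) := {x | IsSO (Matrix.of fun a b => p a b x : Mat n)}
  have hS : MeasurableSet S :=
    (isClosed_setOf_isSO n).measurableSet.preimage
      (measurable_pi_iff.2 fun a => measurable_pi_iff.2 fun b => hpm a b)
  obtain ⟨ns, -, hae⟩ := exists_subseq_ae_tendsto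
    (f := fun k (j : Fin n × Fin n) x => P k x j.1 j.2)
    (F := fun j => p j.1 j.2) (fun k j => (h k).measurable j.1 j.2) (fun j => hpm j.1 j.2)
    fun j => hs j.1 j.2
  have hSae : ∀ᵐ x ∂volume.restrict (ballUnit 2), x ∈ S := by
    filter_upwards [hae] with x hx
    change (fun a b => p a b x) ∈ {A : Fin n → Fin n → ℝ | IsSO (Matrix.of A : Mat n)}
    refine (isClosed_setOf_isSO n).mem_of_tendsto (f := fun k a b => P (ns k) x a b) (b := atTop)
      (tendsto_pi_nhds.2 fun a => tendsto_pi_nhds.2 fun b => hx (a, b))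
      (Eventually.of_forall fun k => (h (ns k)).isSO x)
  let Q : Euc 2 → Mat n := fun x => if x ∈ S then Matrix.of fun a b => p a b x else 1
  have hQp : ∀ a b, (fun x => p a b x) =ᵐ[volume.restrict (ballUnit 2)] fun x => Q x a b := by
    intro a b
    filter_upwards [hSae] with x hx
    simp [Q, hx]
  have hQm : ∀ a b, Measurable fun x => Q x a b := by
    intro a b
    have e : (fun x => Q x a b) = fun x => if x ∈ S then p a b x else (1 : Mat n) a b := by
      funext x
      by_cases hx : x ∈ S <;> simp [Q, hx]
    rw [e]
    exact Measurable.ite hS (hpm a b) measurable_const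
  have hQso : ∀ x, IsSO (Q x) := by
    intro x
    by_cases hx : x ∈ S
    · have hx' : IsSO (Matrix.of fun a b => p a b x : Mat n) := hx
      simpa only [Q, if_pos hx] using hx'
    · simpa [Q, hx] using isSO_one
  have hQ2 : ∀ a b, MemL2 fun x => Q x a b := fun a b =>
    memLp_of_bounded (hQm a b) fun x => (hQso x).abs_apply_le_one a b
  have hsQ : ∀ a b, Tendsto (fun k => ∫⁻ x in ballUnit 2, ‖P k x a b - Q x a b‖ₑ ^ 2) atTop
      (𝓝 0) := by
    intro a b
    refine (hs a b).congr fun k => lintegral_congr_ae ?_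
    filter_upwards [hQp a b] with x hx
    rw [hx]
  have hwQ : ∀ a b ψ, MemL2 ψ → Tendsto (fun k => ∫ x in ballUnit 2, P k x a b * ψ x) atTop
      (𝓝 (∫ x in ballUnit 2, Q x a b * ψ x)) := by
    intro a b ψ hψ
    have e : ∫ x in ballUnit 2, Q x a b * ψ x = ∫ x in ballUnit 2, p a b x * ψ x :=
      integral_congr_ae ((hQp a b).mono fun x hx => congrArg (· * ψ x) hx.symm)
    rw [e]
    exact hwp a b ψ hψ
  refine ⟨Q, hQso, hQm, hYa, hY, fun i a b φ hφ => ?_⟩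
  have h1 := hwQ a b _ ((hφ.pd i).memLp 2 _)
  have hXP : ∀ c, Tendsto (fun k => ∫ x in ballUnit 2, φ x * (X k x i a c * P k x c b)) atTop
      (𝓝 (∫ x in ballUnit 2, φ x * (Y x i a c * Q x c b))) := fun c =>
    tendsto_integral_test_mul hφ (fun k => (h k).memLp i a c) (fun k => (h k).memL2_apply c b)
      (hQ2 c b) hM (fun k => hXM k i a c) (hwY i a c) (hsQ c b)
  have hPO : ∀ c, Tendsto (fun k => ∫ x in ballUnit 2, φ x * (P k x a c * Ω x i c b)) atTop
      (𝓝 (∫ x in ballUnit 2, φ x * (Q x a c * Ω x i c b))) := by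
    intro c
    have := hwQ a c _ (memLp_continuous_mul hφ.continuous (hΩ i c b))
    simpa only [mul_left_comm (φ _)] using this
  have hsplit : ∀ {A : Euc 2 → Mat n} {Z : Euc 2 → Fin 2 → Mat n},
      (∀ c, MemL2 fun x => Z x i a c * A x c b) → (∀ c, MemL2 fun x => A x a c * Ω x i c b) →
      ∫ x in ballUnit 2, φ x * (Z x i * A x + A x * Ω x i) a b =
        ∑ c, ((∫ x in ballUnit 2, φ x * (Z x i a c * A x c b)) +
          ∫ x in ballUnit 2, φ x * (A x a c * Ω x i c b)) := by
    intro A Z h1 h2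
    have i1 := fun c => integrable_test_mul hφ (h1 c)
    have i2 := fun c => integrable_test_mul hφ (h2 c)
    simp only [Matrix.add_apply, Matrix.mul_apply, mul_add, Finset.mul_sum]
    rw [integral_add (integrable_finsetSum _ fun c _ => i1 c)
      (integrable_finsetSum _ fun c _ => i2 c), integral_finsetSum _ fun c _ => i1 c,
      integral_finsetSum _ fun c _ => i2 c, Finset.sum_add_distrib]
  have hQY : ∀ c, MemL2 fun x => Y x i a c * Q x c b := fun c => by
    simpa only [mul_comm] using memLp_bounded_mul (hQm c b)
      (fun x => (hQso x).abs_apply_le_one c b) (hY i a c)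
  have hQO : ∀ c, MemL2 fun x => Q x a c * Ω x i c b := fun c =>
    memLp_bounded_mul (hQm a c) (fun x => (hQso x).abs_apply_le_one a c) (hΩ i c b)
  have h2 := (tendsto_finsetSum Finset.univ fun c _ => (hXP c).add (hPO c)).neg
  rw [← hsplit hQY hQO] at h2
  simp only [mul_comm _ (pd i φ _)] at h1
  refine tendsto_nhds_unique h1 (h2.congr fun k => ?_)
  rw [← hsplit (fun c => (h k).memL2_left i a c c b) fun c => (h k).memL2_right hΩ i a c c b]
  exact ((h k).wd i a b φ hφ).symm

lemma exists_admissible_limit (hΩ : ∀ i a b, MemL2 fun x => Ω x i a b) {P : ℕ → Euc 2 → Mat n}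
    {X : ℕ → Euc 2 → Fin 2 → Mat n} (h : ∀ k, IsAdmissible Ω (P k) (X k)) {C : ℝ}
    (hC : ∀ k, formEnergy (X k) ≤ C) :
    ∃ Q Y, IsAdmissible Ω Q Y ∧ ∃ ns : ℕ → ℕ, StrictMono ns ∧ ∀ i a b ψ, MemL2 ψ →
      Tendsto (fun k => ∫ x in ballUnit 2, X (ns k) x i a b * ψ x) atTop
        (𝓝 (∫ x in ballUnit 2, Y x i a b * ψ x)) := by
  set M : ℝ≥0∞ := volume (ballUnit 2) + ENNReal.ofReal C +
    ENNReal.ofReal (n * (∑ _c : Fin n, (2 * C + 2 * formEnergy Ω))) with hMdef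
  have hM : M ≠ ∞ := by
    have : volume (ballUnit 2) ≠ ∞ := measure_ball_lt_top.ne
    finiteness
  have hPM : ∀ k a b, ∫⁻ x in ballUnit 2, ‖P k x a b‖ₑ ^ 2 ≤ M := by
    intro k a b
    refine le_trans ?_ (le_self_add.trans le_self_add)
    rw [← setLIntegral_one]
    refine lintegral_mono fun x => pow_le_one₀ zero_le ?_
    rw [← ofReal_norm, ENNReal.ofReal_le_one]
    exact ((h k).isSO x).abs_apply_le_one a b
  have hXM : ∀ k i a b, ∫⁻ x in ballUnit 2, ‖X k x i a b‖ₑ ^ 2 ≤ M := by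
    intro k i a b
    refine le_trans ?_ (le_add_self.trans le_self_add)
    rw [lintegral_enorm_sq_eq_ofReal ((h k).memLp i a b)]
    exact ENNReal.ofReal_le_ofReal ((integral_sq_le_formEnergy _ i a b).trans (hC k))
  have hDM : ∀ k i a b,
      ∫⁻ x in ballUnit 2, ‖(X k x i * P k x + P k x * Ω x i) a b‖ₑ ^ 2 ≤ M := by
    intro k i a b
    refine le_trans ?_ le_add_self
    rw [lintegral_enorm_sq_eq_ofReal ((h k).memL2_grad hΩ i a b)]
    refine ENNReal.ofReal_le_ofReal (((h k).integral_grad_sq_le hΩ i a b).trans ?_)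
    gcongr
    exact hC k
  let f : ℕ → ((Fin n × Fin n) ⊕ (Fin 2 × Fin n × Fin n) ⊕ (Fin 2 × Fin n × Fin n)) →
      Euc 2 → ℝ := fun k => Sum.elim (fun j x => P k x j.1 j.2)
    (Sum.elim (fun j x => X k x j.1 j.2.1 j.2.2)
      fun j x => (X k x j.1 * P k x + P k x * Ω x j.1) j.2.1 j.2.2)
  obtain ⟨F, hFm, hF, ns, hns, hw⟩ := exists_weak_subseq (f := f)
    (μ := volume.restrict (ballUnit 2))
    (by
      rintro k (j | j | j)
      · exact (h k).memL2_apply _ _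
      · exact (h k).memLp _ _ _
      · exact (h k).memL2_grad hΩ _ _ _) hM
    (by
      rintro k (j | j | j)
      · exact hPM k _ _
      · exact hXM k _ _ _
      · exact hDM k _ _ _)
  let Y : Euc 2 → Fin 2 → Mat n := fun x i => Matrix.of fun a b =>
    (F (Sum.inr (Sum.inl (i, a, b))) x - F (Sum.inr (Sum.inl (i, b, a))) x) * 2⁻¹
  have hwY : ∀ i a b ψ, MemL2 ψ →
      Tendsto (fun k => ∫ x in ballUnit 2, X (ns k) x i a b * ψ x) atTop
        (𝓝 (∫ x in ballUnit 2, Y x i a b * ψ x)) := by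
    intro i a b ψ hψ
    have h1 := ((hw (Sum.inr (Sum.inl (i, a, b))) ψ hψ).sub
      (hw (Sum.inr (Sum.inl (i, b, a))) ψ hψ)).mul_const 2⁻¹
    have e : ∫ x in ballUnit 2, Y x i a b * ψ x =
        ((∫ x in ballUnit 2, F (Sum.inr (Sum.inl (i, a, b))) x * ψ x) -
          ∫ x in ballUnit 2, F (Sum.inr (Sum.inl (i, b, a))) x * ψ x) * 2⁻¹ := by
      rw [← integral_sub (integrable_mul_of_memLp (hF _) hψ) (integrable_mul_of_memLp (hF _) hψ),
        ← integral_mul_const]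
      refine integral_congr_ae (Eventually.of_forall fun x => ?_)
      simp only [Y, Matrix.of_apply]
      ring
    rw [e]
    refine h1.congr fun k => ?_
    have h2 : ∀ x, X (ns k) x i b a = -X (ns k) x i a b := fun x => by
      have := congrFun (congrFun ((h (ns k)).antisymm x i) a) b
      simpa using this
    simp only [f, Sum.elim_inr, Sum.elim_inl, h2, neg_mul, integral_neg]
    ring
  have hY : ∀ i a b, MemL2 fun x => Y x i a b := fun i a b =>
    ((hF (Sum.inr (Sum.inl (i, a, b)))).sub (hF (Sum.inr (Sum.inl (i, b, a))))).mul_const 2⁻¹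
  have hYa : ∀ x i, IsAntisym (Y x i) := by
    intro x i
    ext a b
    simp only [Y, Matrix.transpose_apply, Matrix.of_apply, Matrix.neg_apply]
    ring
  obtain ⟨Q, hQ⟩ := IsAdmissible.of_limit hΩ (P := fun k => P (ns k)) (X := fun k => X (ns k))
    (fun k => h (ns k)) hM (fun k => hXM (ns k)) (p := fun a b => F (Sum.inl (a, b)))
    (fun a b => hFm _)
    (fun a b => tendsto_lintegral_sub_sq
      (g := fun k i x => (X (ns k) x i * P (ns k) x + P (ns k) x * Ω x i) a b)
      (G := fun i => F (Sum.inr (Sum.inr (i, a, b)))) (fun k => (h (ns k)).measurable a b) (hFm _)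
      (fun k => (h (ns k)).memL2_apply a b) (hF _) (fun k i => (h (ns k)).memL2_grad hΩ i a b)
      (fun i => hF _) (fun k i => (h (ns k)).wd i a b) hM (fun k => hPM (ns k) a b)
      (fun k i => hDM (ns k) i a b) (hw (Sum.inl (a, b)))
      fun i => hw (Sum.inr (Sum.inr (i, a, b))))
    (fun a b => hw (Sum.inl (a, b))) hYa hY hwY
  exact ⟨Q, Y, hQ, ns, hns, hwY⟩

lemma formEnergy_le_of_weak {X : ℕ → Euc 2 → Fin 2 → Mat n} {Y : Euc 2 → Fin 2 → Mat n}
    (hX : ∀ k i a b, MemL2 fun x => X k x i a b) (hY : ∀ i a b, MemL2 fun x => Y x i a b)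
    (hw : ∀ i a b ψ, MemL2 ψ → Tendsto (fun k => ∫ x in ballUnit 2, X k x i a b * ψ x) atTop
      (𝓝 (∫ x in ballUnit 2, Y x i a b * ψ x)))
    {e : ℕ → ℝ} {m : ℝ} (he : ∀ k, formEnergy (X k) ≤ e k) (hm : Tendsto e atTop (𝓝 m)) :
    formEnergy Y ≤ m := by
  have h1 : Tendsto (fun k => 2 * (∑ i, ∑ a, ∑ b, ∫ x in ballUnit 2, X k x i a b * Y x i a b) -
      formEnergy Y) atTop
      (𝓝 (2 * (∑ i, ∑ a, ∑ b, ∫ x in ballUnit 2, Y x i a b * Y x i a b) - formEnergy Y)) :=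
    ((tendsto_finsetSum _ fun i _ => tendsto_finsetSum _ fun a _ => tendsto_finsetSum _
      fun b _ => hw i a b _ (hY i a b)).const_mul 2).sub_const _
  have h2 : 2 * (∑ i, ∑ a, ∑ b, ∫ x in ballUnit 2, Y x i a b * Y x i a b) - formEnergy Y =
      formEnergy Y := by
    simp only [formEnergy, ← sq]
    ring
  rw [h2] at h1
  refine le_of_tendsto_of_tendsto' h1 hm fun k => le_trans ?_ (he k)
  rw [sub_le_iff_le_add, formEnergy, formEnergy, ← Finset.sum_add_distrib, Finset.mul_sum]
  refine Finset.sum_le_sum fun i _ => ?_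
  rw [← Finset.sum_add_distrib, Finset.mul_sum]
  refine Finset.sum_le_sum fun a _ => ?_
  rw [← Finset.sum_add_distrib, Finset.mul_sum]
  refine Finset.sum_le_sum fun b _ => ?_
  rw [← integral_const_mul, ← integral_add (hX k i a b).integrable_sq (hY i a b).integrable_sq]
  refine integral_mono ((integrable_mul_of_memLp (hX k i a b) (hY i a b)).const_mul 2)
    ((hX k i a b).integrable_sq.add (hY i a b).integrable_sq) fun x => ?_
  have := two_mul_le_add_sq (X k x i a b) (Y x i a b)
  simpa only [mul_assoc] using this

lemma isAdmissible_one (hΩa : ∀ x i, IsAntisym (Ω x i)) (hΩ : ∀ i a b, MemL2 fun x => Ω x i a b) :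
    IsAdmissible Ω (fun _ => 1) fun x i => -Ω x i where
  isSO _ := isSO_one
  measurable _ _ := measurable_const
  antisymm x i := by
    have := hΩa x i
    rw [IsAntisym] at this ⊢
    rw [Matrix.transpose_neg, this]
  memLp i a b := (hΩ i a b).neg
  wd i a b := by
    simpa using WD.const i ((1 : Mat n) a b)

lemma exists_minimizer (hΩa : ∀ x i, IsAntisym (Ω x i)) (hΩ : ∀ i a b, MemL2 fun x => Ω x i a b) :
    ∃ P X, IsAdmissible Ω P X ∧ ∀ P' X', IsAdmissible Ω P' X' → formEnergy X ≤ formEnergy X' := by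
  let S : Set ℝ := {e | ∃ P X, IsAdmissible Ω P X ∧ formEnergy X = e}
  have hne : S.Nonempty := ⟨_, _, _, isAdmissible_one hΩa hΩ, rfl⟩
  have hbdd : BddBelow S := by
    refine ⟨0, ?_⟩
    rintro _ ⟨P, X, -, rfl⟩
    exact formEnergy_nonneg X
  have hex : ∀ k : ℕ, ∃ P X, IsAdmissible Ω P X ∧ formEnergy X < sInf S + 1 / ((k : ℝ) + 1) := by
    intro k
    obtain ⟨_, ⟨P, X, h, rfl⟩, hlt⟩ :=
      exists_lt_of_csInf_lt hne (lt_add_of_pos_right (sInf S) (Nat.one_div_pos_of_nat (n := k)))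
    exact ⟨P, X, h, hlt⟩
  choose P X h hlt using hex
  have hC : ∀ k, formEnergy (X k) ≤ sInf S + 1 := fun k => by
    refine (hlt k).le.trans ?_
    gcongr
    exact div_le_one_of_le₀ (by linarith [(Nat.cast_nonneg k : (0 : ℝ) ≤ k)]) (by positivity)
  obtain ⟨Q, Y, hQY, ns, hns, hw⟩ := exists_admissible_limit hΩ h hC
  refine ⟨Q, Y, hQY, fun P' X' h' => ?_⟩
  refine le_trans ?_ (csInf_le hbdd ⟨P', X', h', rfl⟩)
  have hlim : Tendsto (fun k => sInf S + 1 / ((ns k : ℝ) + 1)) atTop (𝓝 (sInf S)) := by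
    have := (tendsto_one_div_add_atTop_nhds_zero_nat (𝕜 := ℝ)).comp hns.tendsto_atTop
    simpa using this.const_add (sInf S)
  exact formEnergy_le_of_weak (X := fun k => X (ns k)) (fun k => (h (ns k)).memLp) hQY.memLp hw
    (fun k => (hlt (ns k)).le) hlim

end Compactness

section Rotation

variable {n : ℕ}

/-- The rotation `exp (s A)` for `A` with `A ^ 3 = -A`. -/
def rot (A : Mat n) (s : ℝ) : Mat n := 1 + Real.sin s • A + (1 - Real.cos s) • (A * A)

variable {A : Mat n}

lemma rot_zero : rot A 0 = 1 := by simp [rot]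

lemma rot_mul_rot (hA : A * (A * A) = -A) (s t : ℝ) : rot A s * rot A t = rot A (s + t) := by
  have h2 : (A * A) * A = -A := by rw [mul_assoc, hA]
  have h3 : (A * A) * (A * A) = -(A * A) := by rw [mul_assoc, hA, mul_neg]
  simp only [rot, mul_add, add_mul, one_mul, mul_one, smul_mul_assoc, mul_smul_comm, hA, h2, h3,
    Real.sin_add, Real.cos_add]
  match_scalars <;> ring

lemma transpose_rot (hAt : A.transpose = -A) (s : ℝ) : (rot A s).transpose = rot A (-s) := by
  simp [rot, hAt, Matrix.transpose_mul]

lemma isSO_rot (hAt : A.transpose = -A) (hA : A * (A * A) = -A) (s : ℝ) : IsSO (rot A s) := by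
  have h1 : ∀ s, (rot A s).transpose * rot A s = 1 := fun s => by
    rw [transpose_rot hAt, rot_mul_rot hA, neg_add_cancel, rot_zero]
  refine ⟨h1 s, ?_⟩
  have h2 := congrArg Matrix.det (h1 (s / 2))
  rw [Matrix.det_mul, Matrix.det_transpose, Matrix.det_one] at h2
  rw [← add_halves s, ← rot_mul_rot hA, Matrix.det_mul, h2]

lemma hasDerivAt_rot_apply (hA : A * (A * A) = -A) (s : ℝ) (a b : Fin n) :
    HasDerivAt (fun s => rot A s a b) ((rot A s * A) a b) s := by
  have h2 : (A * A) * A = -A := by rw [mul_assoc, hA]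
  have e : rot A s * A = Real.cos s • A + Real.sin s • (A * A) := by
    simp only [rot, add_mul, one_mul, smul_mul_assoc, h2]
    match_scalars <;> ring
  rw [e]
  simp only [rot, Matrix.add_apply, Matrix.smul_apply, smul_eq_mul]
  have h3 := (((Real.hasDerivAt_sin s).mul_const (A a b)).const_add ((1 : Mat n) a b)).add
    (((Real.hasDerivAt_cos s).const_sub 1).mul_const ((A * A) a b))
  rw [neg_neg] at h3
  exact h3

lemma contDiff_rot_apply (a b : Fin n) {φ : Euc 2 → ℝ} (hφ : ContDiff ℝ (⊤ : ℕ∞) φ) :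
    ContDiff ℝ (⊤ : ℕ∞) fun x => rot A (φ x) a b := by
  simp only [rot, Matrix.add_apply, Matrix.smul_apply, smul_eq_mul]
  exact (contDiff_const.add (hφ.sin.mul contDiff_const)).add
    ((contDiff_const.sub hφ.cos).mul contDiff_const)

lemma pd_rot_apply (hA : A * (A * A) = -A) (a b : Fin n) {φ : Euc 2 → ℝ}
    (hφ : ContDiff ℝ (⊤ : ℕ∞) φ) (i : Fin 2) (x : Euc 2) :
    pd i (fun x => rot A (φ x) a b) x = pd i φ x * (rot A (φ x) * A) a b := by
  have h := (hasDerivAt_rot_apply hA (φ x) a b).comp_hasFDerivAt x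
    (hφ.differentiable (by simp) x).hasFDerivAt
  change fderiv ℝ ((fun s => rot A s a b) ∘ φ) x _ = _
  rw [h.fderiv]
  simp [pd, mul_comm]

lemma continuous_pd {φ : Euc 2 → ℝ} (hφ : ContDiff ℝ (⊤ : ℕ∞) φ) (i : Fin 2) :
    Continuous (pd i φ) :=
  (hφ.continuous_fderiv (by simp)).clm_apply continuous_const

lemma IsSO.mul {A B : Mat n} (hA : IsSO A) (hB : IsSO B) : IsSO (A * B) := by
  refine ⟨?_, by rw [Matrix.det_mul, hA.2, hB.2, mul_one]⟩
  rw [Matrix.transpose_mul, Matrix.mul_assoc, ← Matrix.mul_assoc A.transpose, hA.1, Matrix.one_mul,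
    hB.1]

lemma sum_sq_eq_trace (W : Mat n) : ∑ a, ∑ b, W a b ^ 2 = (W.transpose * W).trace := by
  simp only [Matrix.trace, Matrix.diag_apply, Matrix.mul_apply, Matrix.transpose_apply, ← sq]
  exact Finset.sum_comm

lemma sum_sq_conj {R : Mat n} (hR : R.transpose * R = 1) (W : Mat n) :
    ∑ a, ∑ b, (R * W * R.transpose) a b ^ 2 = ∑ a, ∑ b, W a b ^ 2 := by
  have e : (R * W * R.transpose).transpose * (R * W * R.transpose) =
      R * (W.transpose * ((R.transpose * R) * (W * R.transpose))) := by
    simp only [Matrix.transpose_mul, Matrix.transpose_transpose, Matrix.mul_assoc]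
  rw [sum_sq_eq_trace, sum_sq_eq_trace, e, hR, Matrix.one_mul, Matrix.trace_mul_comm,
    Matrix.mul_assoc, Matrix.mul_assoc, hR, Matrix.mul_one]

end Rotation

section EulerLagrange

variable {n : ℕ} {Ω X : Euc 2 → Fin 2 → Mat n} {P : Euc 2 → Mat n} {A : Mat n} {φ : Euc 2 → ℝ}

lemma memL2_pd (hφ : ContDiff ℝ (⊤ : ℕ∞) φ) (i : Fin 2) : MemL2 (pd i φ) := by
  simpa using memLp_continuous_mul (continuous_pd hφ i) (memLp_const (1 : ℝ))

lemma IsAdmissible.rotate (h : IsAdmissible Ω P X) (hΩ : ∀ i a b, MemL2 fun x => Ω x i a b)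
    (hAt : A.transpose = -A) (hA : A * (A * A) = -A) (hφ : ContDiff ℝ (⊤ : ℕ∞) φ) :
    IsAdmissible Ω (fun x => rot A (φ x) * P x) fun x i =>
      rot A (φ x) * (pd i φ x • A + X x i) * (rot A (φ x)).transpose where
  isSO x := (isSO_rot hAt hA _).mul (h.isSO x)
  measurable a b := by
    simp only [Matrix.mul_apply]
    exact Finset.measurable_fun_sum _ fun c _ =>
      (contDiff_rot_apply a c hφ).continuous.measurable.mul (h.measurable c b)
  antisymm x i := by
    have hX : (X x i).transpose = -X x i := h.antisymm x i
    simp only [IsAntisym, Matrix.transpose_mul, Matrix.transpose_transpose, Matrix.transpose_add,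
      Matrix.transpose_smul, hAt, hX, Matrix.mul_assoc]
    rw [← Matrix.mul_neg, ← Matrix.neg_mul]
    congr 2
    module
  memLp i a b := by
    simp only [Matrix.mul_apply, Matrix.transpose_apply, Finset.sum_mul, Matrix.add_apply,
      Matrix.smul_apply, smul_eq_mul]
    refine memLp_finsetSum _ fun d _ => memLp_finsetSum _ fun c _ => ?_
    have h1 : MemL2 fun x => pd i φ x * A c d + X x i c d :=
      ((memL2_pd hφ i).mul_const _).add (h.memLp i c d)
    have h2 := memLp_continuous_mul (contDiff_rot_apply (A := A) b d hφ).continuous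
      (memLp_continuous_mul (contDiff_rot_apply (A := A) a c hφ).continuous h1)
    simpa only [mul_comm (rot A _ b d)] using h2
  wd i a b := by
    have h1 : WD i (fun x => ∑ c, rot A (φ x) a c * P x c b) fun x =>
        ∑ c, (pd i (fun x => rot A (φ x) a c) x * P x c b +
          rot A (φ x) a c * (X x i * P x + P x * Ω x i) c b) := by
      refine WD.sum (fun c _ => (h.wd i c b).smooth_mul (contDiff_rot_apply a c hφ)
        (h.memL2_apply c b) (h.memL2_grad hΩ i c b)) (fun c _ => ?_) fun c _ => ?_
      · exact memLp_continuous_mul (contDiff_rot_apply a c hφ).continuous (h.memL2_apply c b)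
      · exact (memLp_continuous_mul (continuous_pd (contDiff_rot_apply a c hφ) i)
          (h.memL2_apply c b)).add
          (memLp_continuous_mul (contDiff_rot_apply a c hφ).continuous (h.memL2_grad hΩ i c b))
    refine h1.congr_ae (Eventually.of_forall fun x => (Matrix.mul_apply ..).symm)
      (Eventually.of_forall fun x => ?_)
    have e : rot A (φ x) * (pd i φ x • A + X x i) * (rot A (φ x)).transpose *
        (rot A (φ x) * P x) + rot A (φ x) * P x * Ω x i =
        (pd i φ x • (rot A (φ x) * A)) * P x + rot A (φ x) * (X x i * P x + P x * Ω x i) := by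
      rw [Matrix.mul_assoc _ (rot A (φ x)).transpose, ← Matrix.mul_assoc _ (rot A (φ x)) (P x),
        (isSO_rot hAt hA _).1, Matrix.one_mul]
      simp only [Matrix.mul_add, Matrix.add_mul, Matrix.mul_smul, Matrix.smul_mul,
        Matrix.mul_assoc]
      abel
    simp only [e]
    rw [Matrix.add_apply, Matrix.mul_apply, Matrix.mul_apply, ← Finset.sum_add_distrib]
    simp only [pd_rot_apply hA _ _ hφ, Matrix.smul_apply, smul_eq_mul]

lemma formEnergy_eq_integral (hX : ∀ i a b, MemL2 fun x => X x i a b) :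
    formEnergy X = ∫ x in ballUnit 2, ∑ i, ∑ a, ∑ b, X x i a b ^ 2 := by
  have h := fun i a b => (hX i a b).integrable_sq
  rw [formEnergy, integral_finsetSum _ fun i _ => integrable_finsetSum _ fun a _ =>
    integrable_finsetSum _ fun b _ => h i a b]
  refine Finset.sum_congr rfl fun i _ => ?_
  rw [integral_finsetSum _ fun a _ => integrable_finsetSum _ fun b _ => h i a b]
  refine Finset.sum_congr rfl fun a _ => ?_
  rw [integral_finsetSum _ fun b _ => h i a b]

lemma formEnergy_add_smul (hX : ∀ i a b, MemL2 fun x => X x i a b) {U : Euc 2 → Fin 2 → Mat n}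
    (hU : ∀ i a b, MemL2 fun x => U x i a b) (t : ℝ) :
    formEnergy (fun x i => X x i + t • U x i) = formEnergy X +
      2 * t * (∑ i, ∑ a, ∑ b, ∫ x in ballUnit 2, U x i a b * X x i a b) +
        t ^ 2 * formEnergy U := by
  simp only [formEnergy, Finset.mul_sum, ← Finset.sum_add_distrib]
  refine Finset.sum_congr rfl fun i _ => Finset.sum_congr rfl fun a _ =>
    Finset.sum_congr rfl fun b _ => ?_
  have h1 := (hX i a b).integrable_sq
  have h2 := (integrable_mul_of_memLp (hU i a b) (hX i a b)).const_mul (2 * t)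
  have h3 := (hU i a b).integrable_sq.const_mul (t ^ 2)
  have h12 : Integrable (fun x => X x i a b ^ 2 + 2 * t * (U x i a b * X x i a b))
    (volume.restrict (ballUnit 2)) := h1.add h2
  rw [← integral_const_mul, ← integral_const_mul, ← integral_add h1 h2, ← integral_add h12 h3]
  refine integral_congr_ae (Eventually.of_forall fun x => ?_)
  simp only [Matrix.add_apply, Matrix.smul_apply, smul_eq_mul]
  ring

lemma eq_zero_of_forall_quadratic_nonneg {b c : ℝ} (h : ∀ t : ℝ, 0 ≤ 2 * t * b + t ^ 2 * c) :
    b = 0 := by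
  by_contra hb
  have h1 := h (-b / (|c| + 1))
  have hc : 0 < |c| + 1 := by positivity
  have e : 2 * (-b / (|c| + 1)) * b + (-b / (|c| + 1)) ^ 2 * c =
      (b ^ 2 / (|c| + 1) ^ 2) * (c - 2 * (|c| + 1)) := by
    field_simp
    ring
  rw [e] at h1
  have h2 : 0 < b ^ 2 / (|c| + 1) ^ 2 := by positivity
  nlinarith [le_abs_self c, abs_nonneg c]

lemma IsAdmissible.integral_pd_mul_eq_zero (h : IsAdmissible Ω P X)
    (hΩ : ∀ i a b, MemL2 fun x => Ω x i a b)
    (hmin : ∀ P' X', IsAdmissible Ω P' X' → formEnergy X ≤ formEnergy X')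
    (hφ : ContDiff ℝ (⊤ : ℕ∞) φ) (a b : Fin n) :
    ∑ i, ∫ x in ballUnit 2, pd i φ x * X x i a b = 0 := by
  have hXs : ∀ x i a b, X x i b a = -X x i a b := fun x i a b => by
    simpa using congrFun (congrFun (h.antisymm x i) a) b
  by_cases hab : a = b
  · subst hab
    have h0 : ∀ x i, X x i a a = 0 := fun x i => by
      have := hXs x i a a
      linarith
    simp [h0]
  set A : Mat n := Matrix.single a b 1 - Matrix.single b a 1 with hAdef
  have hAt : A.transpose = -A := by simp [hAdef]
  have hA : A * (A * A) = -A := by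
    have hba : b ≠ a := Ne.symm hab
    simp [hAdef, mul_sub, sub_mul, Matrix.single_mul_single_same, Matrix.single_mul_single_of_ne,
      hab, hba]
    abel
  have hU : ∀ i c d, MemL2 fun x => (pd i φ x • A) c d := fun i c d =>
    (memL2_pd hφ i).mul_const (A c d)
  have hkey : ∀ t : ℝ, 0 ≤ 2 * t * (∑ i, ∑ c, ∑ d, ∫ x in ballUnit 2,
      (pd i φ x • A) c d * X x i c d) + t ^ 2 * formEnergy fun x i => pd i φ x • A := by
    intro t
    have hφt : ContDiff ℝ (⊤ : ℕ∞) fun x => t * φ x := contDiff_const.mul hφ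
    have hadm := h.rotate hΩ hAt hA hφt
    have h1 := hmin _ _ hadm
    have hpd : ∀ i x, pd i (fun x => t * φ x) x = t * pd i φ x := by
      intro i x
      simp only [pd]
      rw [fderiv_const_mul (hφ.differentiable (by simp) x)]
      simp
    have h2 := formEnergy_add_smul h.memLp hU t
    have hXU : ∀ i c d, MemL2 fun x => (X x i + t • pd i φ x • A) c d := fun i c d =>
      (h.memLp i c d).add ((hU i c d).const_mul t)
    have h3 : formEnergy (fun x i => rot A (t * φ x) * (pd i (fun x => t * φ x) x • A + X x i) *
        (rot A (t * φ x)).transpose) = formEnergy fun x i => X x i + t • pd i φ x • A := by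
      rw [formEnergy_eq_integral hadm.memLp, formEnergy_eq_integral hXU]
      refine integral_congr_ae (Eventually.of_forall fun x => ?_)
      simp only [sum_sq_conj (isSO_rot hAt hA _).1, hpd, smul_smul, add_comm (X _ _)]
    rw [h3, h2] at h1
    linarith
  have h4 := eq_zero_of_forall_quadratic_nonneg hkey
  have h5 : ∀ i, ∑ c, ∑ d, ∫ x in ballUnit 2, (pd i φ x • A) c d * X x i c d =
      2 * ∫ x in ballUnit 2, pd i φ x * X x i a b := by
    intro i
    have e : ∀ c d, ∫ x in ballUnit 2, (pd i φ x • A) c d * X x i c d =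
        A c d * ∫ x in ballUnit 2, pd i φ x * X x i c d := by
      intro c d
      rw [← integral_const_mul]
      refine integral_congr_ae (Eventually.of_forall fun x => ?_)
      simp only [Matrix.smul_apply, smul_eq_mul]
      ring
    have e2 : ∫ x in ballUnit 2, pd i φ x * X x i b a =
        -∫ x in ballUnit 2, pd i φ x * X x i a b := by
      rw [← integral_neg]
      simp only [hXs _ i a b, mul_neg]
    simp only [e]
    simp only [hAdef, Matrix.sub_apply, Matrix.single_apply, sub_mul, Finset.sum_sub_distrib,
      ite_mul, one_mul, zero_mul, ite_and, Finset.sum_ite_eq, Finset.mem_univ, if_true,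
      Finset.sum_ite_irrel, Finset.sum_const_zero, e2]
    ring
  simp only [h5, ← Finset.mul_sum] at h4
  linarith

end EulerLagrange

section Potential

lemma stronglyMeasurable_segAvg {Y : Euc 2 → ℝ} (h : Euc 2) (hY : StronglyMeasurable Y) :
    StronglyMeasurable (segAvg h Y) := by
  have hm : StronglyMeasurable fun z : Euc 2 × ℝ => Y (z.1 + z.2 • h) :=
    hY.comp_measurable (by fun_prop)
  have e : segAvg h Y = fun y => ∫ t in Ioc (0 : ℝ) 1, Y (y + t • h) := by
    funext y
    rw [segAvg, intervalIntegral.integral_of_le zero_le_one]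
  have h' := hm.integral_prod_right' (ν := volume.restrict (Ioc (0 : ℝ) 1))
  rwa [e]

/-- Averaging along `-h` is the adjoint of averaging along `h`. -/
lemma integral_mul_segAvg_neg {ψ Y : Euc 2 → ℝ} (h : Euc 2) (hψ : Continuous ψ) {C : ℝ}
    (hC : ∀ x, ‖ψ x‖ ≤ C) (hYm : StronglyMeasurable Y) (hY : Integrable Y) :
    ∫ x, ψ x * segAvg (-h) Y x = ∫ y, segAvg h ψ y * Y y := by
  set ν : Measure ℝ := volume.restrict (Ioc 0 1)
  have i1 : Integrable (fun z : Euc 2 × ℝ => Y (z.1 + z.2 • -h)) (volume.prod ν) := by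
    have hm : StronglyMeasurable fun z : Euc 2 × ℝ => Y (z.1 + z.2 • -h) :=
      hYm.comp_measurable (by fun_prop)
    refine ⟨hm.aestronglyMeasurable, ?_⟩
    rw [HasFiniteIntegral, lintegral_prod_symm _ hm.enorm.aemeasurable]
    simp only [lintegral_add_right_eq_self (fun y => ‖Y y‖ₑ)]
    simpa [ν] using hasFiniteIntegral_iff_enorm.1 hY.2
  have i1' : Integrable (fun z : Euc 2 × ℝ => ψ z.1 * Y (z.1 + z.2 • -h)) (volume.prod ν) :=
    i1.bdd_mul (c := C) (Continuous.aestronglyMeasurable (by fun_prop))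
      (Eventually.of_forall fun z => hC _)
  have i2 : Integrable (fun z : Euc 2 × ℝ => ψ (z.1 + z.2 • h) * Y z.1) (volume.prod ν) :=
    (hY.comp_fst ν).bdd_mul (c := C) (Continuous.aestronglyMeasurable (by fun_prop))
      (Eventually.of_forall fun z => hC _)
  calc ∫ x, ψ x * segAvg (-h) Y x
      = ∫ x, ∫ t, ψ x * Y (x + t • -h) ∂ν := by
        refine integral_congr_ae (Eventually.of_forall fun x => ?_)
        simp only [segAvg, intervalIntegral.integral_of_le zero_le_one, ν, integral_const_mul]
    _ = ∫ t, ∫ x, ψ x * Y (x + t • -h) ∂volume ∂ν :=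
        integral_integral_swap (f := fun x t => ψ x * Y (x + t • -h)) i1'
    _ = ∫ t, ∫ y, ψ (y + t • h) * Y y ∂volume ∂ν := by
        refine integral_congr_ae (Eventually.of_forall fun t => ?_)
        have := integral_add_right_eq_self (μ := (volume : Measure (Euc 2)))
          (fun x => ψ x * Y (x + t • -h)) (t • h)
        simp only [← this]
        refine integral_congr_ae (Eventually.of_forall fun x => ?_)
        simp
    _ = ∫ y, ∫ t, ψ (y + t • h) * Y y ∂ν :=
        (integral_integral_swap (f := fun y t => ψ (y + t • h) * Y y) i2).symm
    _ = ∫ y, segAvg h ψ y * Y y := by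
        refine integral_congr_ae (Eventually.of_forall fun x => ?_)
        simp only [segAvg, intervalIntegral.integral_of_le zero_le_one, ν, integral_mul_const]

/-- The vector `4 e₀`, longer than the diameter of the unit disc. -/
def longVec : Euc 2 := (4 : ℝ) • EuclideanSpace.single 0 1

lemma add_longVec_notMem {y : Euc 2} (hy : y ∈ ballUnit 2) : y + longVec ∉ ballUnit 2 := by
  intro h
  have h1 : ‖y‖ < 1 := by simpa [ballUnit, ballR] using hy
  have h2 : ‖y + longVec‖ < 1 := by simpa [ballUnit, ballR] using h
  have h3 : ‖longVec‖ = 4 := by simp [longVec, norm_smul]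
  have h4 : ‖longVec‖ ≤ ‖y + longVec‖ + ‖y‖ := by
    simpa using norm_sub_le (y + longVec) y
  linarith

/-- The primitive of `-Y` in the direction `e₀` which vanishes to the left of the disc. -/
def potential (Y : Euc 2 → ℝ) (x : Euc 2) : ℝ := -4 * segAvg (-longVec) Y x

lemma stronglyMeasurable_potential {Y : Euc 2 → ℝ} (hY : StronglyMeasurable Y) :
    StronglyMeasurable (potential Y) :=
  (stronglyMeasurable_segAvg _ hY).const_mul _

lemma potential_neg (Y : Euc 2 → ℝ) (x : Euc 2) : potential (fun y => -Y y) x = -potential Y x := by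
  simp [potential, segAvg]

lemma lintegral_potential_sq_le {Y : Euc 2 → ℝ} (hY : StronglyMeasurable Y)
    (hY0 : ∀ x ∉ ballUnit 2, Y x = 0) :
    ∫⁻ x in ballUnit 2, ‖potential Y x‖ₑ ^ 2 ≤ 16 * ∫⁻ x in ballUnit 2, ‖Y x‖ₑ ^ 2 := by
  have e : ∀ x, ‖potential Y x‖ₑ ^ 2 = 16 * ‖segAvg (-longVec) Y x‖ₑ ^ 2 := by
    intro x
    have h4 : ‖(4 : ℝ)‖ₑ = 4 := by
      rw [← ofReal_norm]
      norm_num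
    rw [potential, enorm_mul, mul_pow, enorm_neg, h4]
    norm_num
  simp only [e]
  rw [lintegral_const_mul' _ _ (by simp)]
  refine mul_le_mul_right ?_ _
  refine (setLIntegral_le_lintegral _ _).trans ((lintegral_segAvg_sq_le _ hY).trans_eq ?_)
  refine (setLIntegral_eq_of_support_subset ?_).symm
  intro x hx
  by_contra h
  simp [hY0 x h] at hx

lemma integral_pd_mul_potential {Y : Euc 2 → ℝ} (hYm : StronglyMeasurable Y)
    (hY0 : ∀ x ∉ ballUnit 2, Y x = 0) (hY : MemL2 Y) {φ : Euc 2 → ℝ}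
    (hφ : IsTestFun (ballUnit 2) φ) (i : Fin 2) :
    ∫ x in ballUnit 2, pd i φ x * potential Y x =
      -4 * ∫ x in ballUnit 2, pd i (segAvg longVec φ) x * Y x := by
  have hc : Continuous (pd i φ) := (hφ.pd i).continuous
  obtain ⟨C, hC⟩ := hc.bounded_above_of_compact_support (hφ.pd i).supp_compact
  have hYi : Integrable Y := by
    have h1 : IntegrableOn Y (ballUnit 2) := hY.integrable (by norm_num)
    refine (integrableOn_iff_integrable_of_support_subset fun x hx => ?_).1 h1
    by_contra h
    exact hx (hY0 x h)
  have h1 := integral_mul_segAvg_neg longVec hc hC hYm hYi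
  rw [setIntegral_test (hφ.pd i), pd_segAvg _ (hφ.smooth.of_le (by simp)),
    setIntegral_eq_integral_of_forall_compl_eq_zero fun x hx => by simp [hY0 x hx], ← h1,
    ← integral_const_mul]
  refine integral_congr_ae (Eventually.of_forall fun x => ?_)
  simp only [potential]
  ring

lemma pd_zero_segAvg {φ : Euc 2 → ℝ} (hφ : IsTestFun (ballUnit 2) φ) {y : Euc 2}
    (hy : y ∈ ballUnit 2) : 4 * pd 0 (segAvg longVec φ) y = -φ y := by
  have h := fderiv_segAvg_apply longVec (hφ.smooth.of_le (by simp)) y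
  rw [hφ.eq_zero (add_longVec_notMem hy), zero_sub] at h
  rw [← h]
  conv_rhs => rw [longVec, map_smul, smul_eq_mul]
  rfl

lemma WD.potential_zero {Y : Euc 2 → ℝ} (hYm : StronglyMeasurable Y)
    (hY0 : ∀ x ∉ ballUnit 2, Y x = 0) (hY : MemL2 Y) :
    WD 0 (potential Y) fun x => -Y x := by
  intro φ hφ
  rw [integral_pd_mul_potential hYm hY0 hY hφ, ← integral_const_mul, ← integral_neg]
  refine setIntegral_congr_fun measurableSet_ballUnit fun x hx => ?_
  have := pd_zero_segAvg hφ hx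
  simp only
  linear_combination (-Y x) * this

lemma WD.potential_one {Y Z : Euc 2 → ℝ} (hYm : StronglyMeasurable Y)
    (hY0 : ∀ x ∉ ballUnit 2, Y x = 0) (hY : MemL2 Y)
    (hdiv : ∀ φ : Euc 2 → ℝ, ContDiff ℝ (⊤ : ℕ∞) φ →
      (∫ x in ballUnit 2, pd 0 φ x * Z x) + ∫ x in ballUnit 2, pd 1 φ x * Y x = 0) :
    WD 1 (potential Y) Z := by
  intro φ hφ
  have h1 := hdiv _ (contDiff_segAvg longVec hφ.smooth)
  have h2 : ∫ x in ballUnit 2, φ x * Z x =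
      -4 * ∫ x in ballUnit 2, pd 0 (segAvg longVec φ) x * Z x := by
    rw [← integral_const_mul]
    refine setIntegral_congr_fun measurableSet_ballUnit fun x hx => ?_
    have := pd_zero_segAvg hφ hx
    linear_combination (Z x) * this
  rw [integral_pd_mul_potential hYm hY0 hY hφ, h2]
  linear_combination (-4) * h1

end Potential

section Gauge

variable {n : ℕ} {Ω : Euc 2 → Fin 2 → Mat n} {P : Euc 2 → Mat n} {X : Euc 2 → Fin 2 → Mat n}

lemma IsAdmissible.exists_antisymm_rep (h : IsAdmissible Ω P X) (i : Fin 2) :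
    ∃ Y : Fin n → Fin n → Euc 2 → ℝ, (∀ a b, StronglyMeasurable (Y a b)) ∧
      (∀ a b, ∀ x ∉ ballUnit 2, Y a b x = 0) ∧ (∀ a b x, Y a b x = -Y b a x) ∧
      ∀ a b, Y a b =ᵐ[volume.restrict (ballUnit 2)] fun x => X x i a b := by
  let m : Fin n → Fin n → Euc 2 → ℝ := fun a b => (h.memLp i a b).1.mk
  have hm : ∀ a b, StronglyMeasurable (m a b) := fun a b => (h.memLp i a b).1.stronglyMeasurable_mk
  have hmX : ∀ a b, (fun x => X x i a b) =ᵐ[volume.restrict (ballUnit 2)] m a b :=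
    fun a b => (h.memLp i a b).1.ae_eq_mk
  refine ⟨fun a b => (ballUnit 2).indicator fun x => (m a b x - m b a x) / 2, fun a b => ?_,
    fun a b x hx => indicator_of_notMem hx _, fun a b x => ?_, fun a b => ?_⟩
  · exact ((((hm a b).measurable.sub (hm b a).measurable).div_const 2).stronglyMeasurable).indicator
      measurableSet_ballUnit
  · by_cases hx : x ∈ ballUnit 2
    · simp only [indicator_of_mem hx]
      ring
    · simp only [indicator_of_notMem hx, neg_zero]
  · filter_upwards [hmX a b, hmX b a, ae_restrict_mem measurableSet_ballUnit] with x h1 h2 hx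
    have h3 : X x i b a = -X x i a b := by
      have := congrFun (congrFun (h.antisymm x i) a) b
      simpa using this
    rw [indicator_of_mem hx, ← h1, ← h2, h3]
    ring

/-- The connection form of a minimizer is the rotated gradient of an antisymmetric potential. -/
lemma IsAdmissible.exists_potential (h : IsAdmissible Ω P X)
    (hΩ : ∀ i a b, MemL2 fun x => Ω x i a b)
    (hmin : ∀ P' X', IsAdmissible Ω P' X' → formEnergy X ≤ formEnergy X') :
    ∃ ξ : Euc 2 → Mat n, (∀ x, IsAntisym (ξ x)) ∧ (∀ a b, MemL2 fun x => ξ x a b) ∧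
      (∀ a b, WD 0 (fun x => ξ x a b) fun x => -X x 1 a b) ∧
      (∀ a b, WD 1 (fun x => ξ x a b) fun x => X x 0 a b) ∧
      ∀ a b, ∫⁻ x in ballUnit 2, ‖ξ x a b‖ₑ ^ 2 ≤ 16 * ENNReal.ofReal (formEnergy X) := by
  obtain ⟨Y, hYm, hY0, hYa, hYX⟩ := h.exists_antisymm_rep 1
  have hY : ∀ a b, MemL2 (Y a b) := fun a b => (memLp_congr_ae (hYX a b)).2 (h.memLp 1 a b)
  have hbound : ∀ a b, ∫⁻ x in ballUnit 2, ‖potential (Y a b) x‖ₑ ^ 2 ≤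
      16 * ENNReal.ofReal (formEnergy X) := by
    intro a b
    refine (lintegral_potential_sq_le (hYm a b) (hY0 a b)).trans (mul_le_mul_right ?_ _)
    rw [lintegral_enorm_sq_eq_ofReal (hY a b),
      integral_congr_ae ((hYX a b).mono fun x hx => congrArg (· ^ 2) hx)]
    exact ENNReal.ofReal_le_ofReal (integral_sq_le_formEnergy X 1 a b)
  refine ⟨fun x => Matrix.of fun a b => potential (Y a b) x, fun x => ?_, fun a b => ?_,
    fun a b => ?_, fun a b => ?_, hbound⟩
  · ext a b
    have e : Y b a = fun x => -Y a b x := funext fun x => hYa b a x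
    simp only [Matrix.transpose_apply, Matrix.of_apply, Matrix.neg_apply, e, potential_neg]
  · exact memLp_two_of_lintegral_sq_lt_top
      (stronglyMeasurable_potential (hYm a b)).aestronglyMeasurable
      ((hbound a b).trans_lt (ENNReal.mul_lt_top (by simp) ENNReal.ofReal_lt_top))
  · exact (WD.potential_zero (hYm a b) (hY0 a b) (hY a b)).congr_ae EventuallyEq.rfl
      ((hYX a b).mono fun x hx => congrArg Neg.neg hx)
  · refine WD.potential_one (hYm a b) (hY0 a b) (hY a b) fun φ hφ => ?_
    have := h.integral_pd_mul_eq_zero hΩ hmin hφ a b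
    rw [Fin.sum_univ_two] at this
    rw [integral_congr_ae ((hYX a b).mono fun x hx => congrArg (pd 1 φ x * ·) hx)]
    exact this

end Gauge

section VectorValued

variable {E ι : Type*} [NormedAddCommGroup E] [NormedSpace ℝ E] [Fintype ι] {v : ι → E}
  {μ : Measure (Euc 2)} {F G : Euc 2 → E} {f g : ι → Euc 2 → ℝ}

/-- `f` is the family of coordinates of `F` with respect to the vectors `v`. -/
def HasCoord (v : ι → E) (F : Euc 2 → E) (f : ι → Euc 2 → ℝ) : Prop :=
  ∀ x, F x = ∑ j, f j x • v j

lemma memLp_of_coord (hF : HasCoord v F f) (hf : ∀ j, MemLp (f j) 2 μ) :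
    MemLp F 2 μ := by
  rw [funext hF]
  exact memLp_finsetSum _ fun j _ =>
    (ContinuousLinearMap.toSpanSingleton ℝ (v j)).comp_memLp' (hf j)

lemma eLpNorm_le_of_coord (hF : HasCoord v F f) (hf : ∀ j, MemLp (f j) 2 μ)
    (hv : ∀ j, ‖v j‖ ≤ 1) : eLpNorm F 2 μ ≤ ∑ j, eLpNorm (f j) 2 μ := by
  have e : F = ∑ j, fun x => f j x • v j := by
    funext x
    rw [Finset.sum_apply, hF]
  rw [e]
  refine (eLpNorm_sum_le (fun j _ => ((ContinuousLinearMap.toSpanSingleton ℝ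
    (v j)).comp_memLp' (hf j)).1) (by norm_num)).trans (Finset.sum_le_sum fun j _ => ?_)
  refine eLpNorm_mono fun x => ?_
  change ‖f j x • v j‖ ≤ _
  rw [norm_smul]
  exact mul_le_of_le_one_right (norm_nonneg _) (hv j)

lemma integral_smul_of_coord [CompleteSpace E] {φ : Euc 2 → ℝ} (hφ : IsTestFun (ballUnit 2) φ)
    (hF : HasCoord v F f) (hf : ∀ j, MemL2 (f j)) :
    ∫ x in ballUnit 2, φ x • F x = ∑ j, (∫ x in ballUnit 2, φ x * f j x) • v j := by
  simp only [hF _, Finset.smul_sum, smul_smul]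
  rw [integral_finsetSum _ fun j _ => (integrable_test_mul hφ (hf j)).smul_const (v j)]
  exact Finset.sum_congr rfl fun j _ => integral_smul_const _ _

lemma mderiv_single1 (i : Fin 2) (φ : Euc 2 → ℝ) : mderiv (single1 i) φ = pd i φ := by
  fin_cases i <;> simp [mderiv, single1, List.finRange_succ]

lemma mdeg_single1 (i : Fin 2) : mdeg (single1 i) = 1 := by
  simp [mdeg, single1]

lemma hasWeakDeriv_zero (Ω : Set (Euc 2)) (F : Euc 2 → E) : HasWeakDeriv Ω 0 F F := by
  intro φ _
  simp [mderiv, mdeg, List.finRange_succ]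

lemma hasWeakDeriv_of_coord [CompleteSpace E] {i : Fin 2} (hF : HasCoord v F f)
    (hG : HasCoord v G g) (hf : ∀ j, MemL2 (f j)) (hg : ∀ j, MemL2 (g j))
    (h : ∀ j, WD i (f j) (g j)) : HasWeakDeriv (ballUnit 2) (single1 i) F G := by
  intro φ hφ
  rw [mderiv_single1, mdeg_single1, integral_smul_of_coord (hφ.pd i) hF hf,
    integral_smul_of_coord hφ hG hg, pow_one, Finset.smul_sum]
  refine Finset.sum_congr rfl fun j _ => ?_
  rw [h j φ hφ, smul_smul, neg_one_mul]

/-- The family of weak derivatives of order at most one with given first derivatives `D`. -/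
def firstJet (F : Euc 2 → E) (D : Euc 2 → Fin 2 → E) (α : Fin 2 → ℕ) : Euc 2 → E :=
  if α = 0 then F else if α = single1 0 then fun x => D x 0 else fun x => D x 1

lemma eq_of_mdeg_le_one {α : Fin 2 → ℕ} (h : mdeg α ≤ 1) :
    α = 0 ∨ α = single1 0 ∨ α = single1 1 := by
  rw [mdeg, Fin.sum_univ_two] at h
  have : (α 0 = 0 ∧ α 1 = 0) ∨ (α 0 = 1 ∧ α 1 = 0) ∨ (α 0 = 0 ∧ α 1 = 1) := by omega
  refine this.imp (fun h => ?_) (Or.imp (fun h => ?_) fun h => ?_) <;>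
    · funext i
      fin_cases i <;> simp [single1, h]

lemma firstJet_zero {E : Type*} (F : Euc 2 → E) (D : Euc 2 → Fin 2 → E) : firstJet F D 0 = F :=
  if_pos rfl

lemma firstJet_single1 {E : Type*} (F : Euc 2 → E) (D : Euc 2 → Fin 2 → E) (i : Fin 2) :
    firstJet F D (single1 i) = fun x => D x i := by
  have h0 : (single1 0 : Fin 2 → ℕ) ≠ 0 := fun h => by simpa [single1] using congrFun h 0
  have h1 : (single1 1 : Fin 2 → ℕ) ≠ 0 := fun h => by simpa [single1] using congrFun h 1
  have h2 : (single1 1 : Fin 2 → ℕ) ≠ single1 0 :=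
    fun h => by simpa [single1] using congrFun h 1
  fin_cases i
  · simp [firstJet, h0]
  · simp [firstJet, h1, h2]

lemma hasWeakDeriv_firstJet {D : Euc 2 → Fin 2 → E}
    (h : ∀ i, HasWeakDeriv (ballUnit 2) (single1 i) F fun x => D x i) {α : Fin 2 → ℕ}
    (hα : mdeg α ≤ 1) : HasWeakDeriv (ballUnit 2) α F (firstJet F D α) := by
  rcases eq_of_mdeg_le_one hα with rfl | rfl | rfl
  · rw [firstJet_zero]
    exact hasWeakDeriv_zero _ _
  · rw [firstJet_single1]
    exact h 0
  · rw [firstJet_single1]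
    exact h 1

lemma memLp_firstJet {E : Type*} [NormedAddCommGroup E] {F : Euc 2 → E}
    {D : Euc 2 → Fin 2 → E} (hF : MemLp F 2 μ)
    (hD : ∀ i, MemLp (fun x => D x i) 2 μ) {α : Fin 2 → ℕ}
    (hα : mdeg α ≤ 1) : MemLp (firstJet F D α) 2 μ := by
  rcases eq_of_mdeg_le_one hα with rfl | rfl | rfl
  · rwa [firstJet_zero]
  · rw [firstJet_single1]
    exact hD 0
  · rw [firstJet_single1]
    exact hD 1

lemma lorentzNormOn_two_two {E : Type*} [NormedAddCommGroup E] {F : Euc 2 → E}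
    (hF : MemLp F 2 (volume.restrict (ballUnit 2))) :
    lorentzNormOn 2 2 (ballUnit 2) F = eLpNorm F 2 (volume.restrict (ballUnit 2)) :=
  lorentzNorm_two_two hF.1

lemma memSL_one {D : Euc 2 → Fin 2 → E} (hF : MemLp F 2 (volume.restrict (ballUnit 2)))
    (hD : ∀ i, MemLp (fun x => D x i) 2 (volume.restrict (ballUnit 2)))
    (h : ∀ i, HasWeakDeriv (ballUnit 2) (single1 i) F fun x => D x i) :
    MemSL 1 2 2 (ballUnit 2) F := by
  refine ⟨firstJet F D, fun α hα => hasWeakDeriv_firstJet h hα, fun α hα => ?_⟩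
  have hm := memLp_firstJet hF hD hα
  refine ⟨hm.1, ?_⟩
  rw [lorentzNormOn_two_two hm]
  exact hm.2

lemma slNorm_one_le {D : Euc 2 → Fin 2 → E} (hF : MemLp F 2 (volume.restrict (ballUnit 2)))
    (hD : ∀ i, MemLp (fun x => D x i) 2 (volume.restrict (ballUnit 2)))
    (h : ∀ i, HasWeakDeriv (ballUnit 2) (single1 i) F fun x => D x i) {M : ℝ≥0∞}
    (hFM : eLpNorm F 2 (volume.restrict (ballUnit 2)) ≤ M)
    (hDM : ∀ i, eLpNorm (fun x => D x i) 2 (volume.restrict (ballUnit 2)) ≤ M) :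
    slNorm 1 2 2 (ballUnit 2) F ≤ (mIdx 2 1).card * M := by
  have hle : slNorm 1 2 2 (ballUnit 2) F ≤
      ∑ α ∈ mIdx 2 1, lorentzNormOn 2 2 (ballUnit 2) (firstJet F D (toMI α)) :=
    sInf_le ⟨firstJet F D, fun α hα => hasWeakDeriv_firstJet h hα, rfl⟩
  refine hle.trans ((Finset.sum_le_card_nsmul _ _ M fun α hα => ?_).trans (nsmul_eq_mul _ _).le)
  have hα : mdeg (toMI α) ≤ 1 := (Finset.mem_filter.1 hα).2
  rw [lorentzNormOn_two_two (memLp_firstJet hF hD hα)]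
  rcases eq_of_mdeg_le_one hα with e | e | e <;> rw [e]
  · rwa [firstJet_zero]
  · rw [firstJet_single1]
    exact hDM 0
  · rw [firstJet_single1]
    exact hDM 1

end VectorValued

section MatrixValued

variable {n : ℕ}

lemma matrix_eq_sum_smul_single (A : Mat n) :
    A = ∑ p : Fin n × Fin n, A p.1 p.2 • Matrix.single p.1 p.2 (1 : ℝ) := by
  conv_lhs => rw [Matrix.matrix_eq_sum_single A]
  rw [Fintype.sum_prod_type]
  simp [Matrix.smul_single]

lemma hasCoord_matrix (F : Euc 2 → Mat n) :
    HasCoord (fun p : Fin n × Fin n => Matrix.single p.1 p.2 (1 : ℝ)) F fun p x => F x p.1 p.2 :=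
  fun x => matrix_eq_sum_smul_single (F x)

lemma norm_single_one_le (a b : Fin n) : ‖(Matrix.single a b (1 : ℝ) : Mat n)‖ ≤ 1 := by
  rw [Matrix.frobenius_norm_def]
  refine Real.rpow_le_one (by positivity) ?_ (by norm_num)
  simp [Matrix.single_apply, ite_and, Finset.sum_ite_eq, apply_ite]

lemma norm_apply_le_norm (A : Mat n) (a b : Fin n) : ‖A a b‖ ≤ ‖A‖ := by
  rw [Matrix.frobenius_norm_def, ← Real.sqrt_eq_rpow]
  refine Real.le_sqrt_of_sq_le ?_
  simp only [Real.rpow_two]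
  refine (Finset.single_le_sum (f := fun b => ‖A a b‖ ^ 2) (fun _ _ => sq_nonneg _)
    (Finset.mem_univ b)).trans ?_
  exact Finset.single_le_sum (f := fun a => ∑ b, ‖A a b‖ ^ 2)
    (fun _ _ => Finset.sum_nonneg fun _ _ => sq_nonneg _) (Finset.mem_univ a)

lemma continuous_apply_apply_matrix (a b : Fin n) : Continuous fun A : Mat n => A a b :=
  LipschitzWith.continuous (K := 1) <| LipschitzWith.of_dist_le_mul fun A B => by
    rw [NNReal.coe_one, one_mul, dist_eq_norm, dist_eq_norm]
    exact norm_apply_le_norm (A - B) a b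

end MatrixValued

section Estimates

variable {n : ℕ}

lemma eLpNorm_le_of_lintegral_sq_le {μ : Measure (Euc 2)} {f : Euc 2 → ℝ} {m : ℕ} {N : ℝ≥0∞}
    (h : ∫⁻ x, ‖f x‖ₑ ^ 2 ∂μ ≤ m * N ^ 2) : eLpNorm f 2 μ ≤ m * N := by
  rw [← eLpNorm_two_sq] at h
  have hm : (m : ℝ≥0∞) ≤ m ^ 2 := mod_cast Nat.le_self_pow (by norm_num) m
  refine (ENNReal.pow_le_pow_left_iff two_ne_zero).1 (h.trans ?_)
  rw [mul_pow]
  gcongr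

lemma memL2_coord {Ω : Euc 2 → Fin 2 → Mat n} (hΩ : MemLp Ω 2 (volume.restrict (ballUnit 2)))
    (i : Fin 2) (a b : Fin n) : MemL2 fun x => Ω x i a b := by
  refine hΩ.of_le ((continuous_apply_apply_matrix a b).comp_aestronglyMeasurable
    ((continuous_apply i).comp_aestronglyMeasurable hΩ.1)) (Eventually.of_forall fun x => ?_)
  exact (norm_apply_le_norm (Ω x i) a b).trans (norm_le_pi_norm (Ω x) i)

lemma eLpNorm_coord_le (Ω : Euc 2 → Fin 2 → Mat n) (μ : Measure (Euc 2)) (i : Fin 2)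
    (a b : Fin n) : eLpNorm (fun x => Ω x i a b) 2 μ ≤ eLpNorm Ω 2 μ :=
  eLpNorm_mono fun x => (norm_apply_le_norm (Ω x i) a b).trans (norm_le_pi_norm (Ω x) i)

lemma ofReal_formEnergy_le {Ω : Euc 2 → Fin 2 → Mat n}
    (hΩ : MemLp Ω 2 (volume.restrict (ballUnit 2))) :
    ENNReal.ofReal (formEnergy Ω) ≤
      (2 * n ^ 2 : ℕ) * eLpNorm Ω 2 (volume.restrict (ballUnit 2)) ^ 2 := by
  have h : ∀ i a b, ENNReal.ofReal (∫ x in ballUnit 2, Ω x i a b ^ 2) ≤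
      eLpNorm Ω 2 (volume.restrict (ballUnit 2)) ^ 2 := by
    intro i a b
    rw [← lintegral_enorm_sq_eq_ofReal (memL2_coord hΩ i a b), ← eLpNorm_two_sq]
    exact pow_le_pow_left' (eLpNorm_coord_le Ω _ i a b) 2
  have h0 : ∀ i a b, 0 ≤ ∫ x in ballUnit 2, Ω x i a b ^ 2 :=
    fun _ _ _ => integral_nonneg fun _ => sq_nonneg _
  rw [formEnergy, ENNReal.ofReal_sum_of_nonneg fun i _ => Finset.sum_nonneg fun a _ =>
    Finset.sum_nonneg fun b _ => h0 i a b]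
  calc _ ≤ ∑ _i : Fin 2, ∑ _a : Fin n, ∑ _b : Fin n,
        eLpNorm Ω 2 (volume.restrict (ballUnit 2)) ^ 2 := by
        refine Finset.sum_le_sum fun i _ => ?_
        rw [ENNReal.ofReal_sum_of_nonneg fun a _ => Finset.sum_nonneg fun b _ => h0 i a b]
        refine Finset.sum_le_sum fun a _ => ?_
        rw [ENNReal.ofReal_sum_of_nonneg fun b _ => h0 i a b]
        exact Finset.sum_le_sum fun b _ => h i a b
    _ = _ := by
        simp only [Finset.sum_const, Finset.card_univ, Fintype.card_fin, nsmul_eq_mul]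
        push_cast
        ring

lemma eLpNorm_matrix_le {μ : Measure (Euc 2)} {F : Euc 2 → Mat n} {M : ℝ≥0∞}
    (hF : ∀ a b, MemLp (fun x => F x a b) 2 μ) (hM : ∀ a b, eLpNorm (fun x => F x a b) 2 μ ≤ M) :
    eLpNorm F 2 μ ≤ (n ^ 2 : ℕ) * M := by
  refine (eLpNorm_le_of_coord (hasCoord_matrix F) (fun p => hF p.1 p.2)
    fun p => norm_single_one_le p.1 p.2).trans ?_
  refine (Finset.sum_le_card_nsmul _ _ M fun p _ => hM p.1 p.2).trans_eq ?_
  rw [nsmul_eq_mul, Finset.card_univ, Fintype.card_prod, Fintype.card_fin, sq]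

lemma memLp_matrix {μ : Measure (Euc 2)} {F : Euc 2 → Mat n}
    (hF : ∀ a b, MemLp (fun x => F x a b) 2 μ) : MemLp F 2 μ :=
  memLp_of_coord (hasCoord_matrix F) fun p => hF p.1 p.2

lemma form_eq_sum_smul_single {E : Type*} [NormedAddCommGroup E] (v : Fin 2 → E) :
    v = Pi.single 0 (v 0) + Pi.single 1 (v 1) := by
  funext i
  fin_cases i <;> simp

lemma norm_form_le {E : Type*} [NormedAddCommGroup E] (v : Fin 2 → E) : ‖v‖ ≤ ‖v 0‖ + ‖v 1‖ := by
  refine (pi_norm_le_iff_of_nonneg (by positivity)).2 fun i => ?_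
  fin_cases i <;> simp

lemma memLp_form {E : Type*} [NormedAddCommGroup E] {μ : Measure (Euc 2)} {F : Euc 2 → Fin 2 → E}
    (hF : ∀ i, MemLp (fun x => F x i) 2 μ) : MemLp F 2 μ := by
  have hm : AEStronglyMeasurable F μ := by
    rw [funext fun x => form_eq_sum_smul_single (F x)]
    exact ((continuous_single 0).comp_aestronglyMeasurable (hF 0).1).add
      ((continuous_single 1).comp_aestronglyMeasurable (hF 1).1)
  exact ((hF 0).norm.add (hF 1).norm).of_le hm
    (Eventually.of_forall fun x => (norm_form_le (F x)).trans (le_abs_self _))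

lemma eLpNorm_form_le {E : Type*} [NormedAddCommGroup E] {μ : Measure (Euc 2)}
    {F : Euc 2 → Fin 2 → E} (hF : ∀ i, MemLp (fun x => F x i) 2 μ) :
    eLpNorm F 2 μ ≤ eLpNorm (fun x => F x 0) 2 μ + eLpNorm (fun x => F x 1) 2 μ := by
  have h : eLpNorm F 2 μ ≤ eLpNorm ((fun x => ‖F x 0‖) + fun x => ‖F x 1‖) 2 μ :=
    eLpNorm_mono fun x => (norm_form_le (F x)).trans (le_abs_self _)
  refine (h.trans (eLpNorm_add_le (hF 0).norm.1 (hF 1).norm.1 (by norm_num))).trans_eq ?_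
  rw [eLpNorm_norm, eLpNorm_norm]

instance : CompleteSpace (Mat n) := FiniteDimensional.complete ℝ (Mat n)

lemma hasWeakDeriv_matrix {i : Fin 2} {F G : Euc 2 → Mat n} (hF : ∀ a b, MemL2 fun x => F x a b)
    (hG : ∀ a b, MemL2 fun x => G x a b)
    (h : ∀ a b, WD i (fun x => F x a b) fun x => G x a b) :
    HasWeakDeriv (ballUnit 2) (single1 i) F G :=
  hasWeakDeriv_of_coord (hasCoord_matrix F) (hasCoord_matrix G) (fun p => hF p.1 p.2)
    (fun p => hG p.1 p.2) fun p => h p.1 p.2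

/-- The dimensional constant in the gauge estimate. -/
def gaugeConst (n : ℕ) : ℕ := 16 * (n ^ 2 + 1) * (2 * n ^ 2)

end Estimates

end CL

open CL in
/-- Uhlenbeck gauge in two dimensions (Theorem 3.2). -/
theorem uhlenbeck_gauge_two_dimensions (n : ℕ) :
    ∃ σ c : ℝ≥0∞, 0 < σ ∧ 0 < c ∧ c < ⊤ ∧
      ∀ Ωf : Euc 2 → Fin 2 → Mat n,
        (∀ x i, IsAntisym (Ωf x i)) →
        MemLorentz 2 2 (ballUnit 2) Ωf →
        lorentzNormOn 2 2 (ballUnit 2) Ωf < σ →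
        ∃ (P : Euc 2 → Mat n) (dP : Euc 2 → Fin 2 → Mat n)
          (ξ : Euc 2 → Mat n) (dξ : Euc 2 → Fin 2 → Mat n),
          (∀ x ∈ ballUnit 2, IsSO (P x)) ∧
          (∀ x, IsAntisym (ξ x)) ∧
          MemSL 1 2 2 (ballUnit 2) P ∧
          MemSL 1 2 2 (ballUnit 2) ξ ∧
          (∀ i, HasWeakDeriv (ballUnit 2) (single1 i) P (fun x => dP x i)) ∧
          (∀ i, HasWeakDeriv (ballUnit 2) (single1 i) ξ (fun x => dξ x i)) ∧
          (∀ᵐ x ∂(volume.restrict (ballUnit 2)), ∀ i,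
            Ωf x i = (P x)⁻¹ * perp (dξ x) i * P x + (P x)⁻¹ * dP x i) ∧
          slNorm 1 2 2 (ballUnit 2) ξ + lorentzNormOn 2 2 (ballUnit 2) dP ≤
            c * lorentzNormOn 2 2 (ballUnit 2) Ωf := by
  set K : ℕ := n ^ 2 * gaugeConst n with hK
  set μ := volume.restrict (ballUnit 2) with hμ
  refine ⟨1, ((mIdx 2 1).card * K + 2 * K + 1 : ℕ), one_pos, by simp,
    ENNReal.natCast_lt_top _, ?_⟩
  intro Ω hΩa hΩL _
  have hnorm : lorentzNormOn 2 2 (ballUnit 2) Ω = eLpNorm Ω 2 μ := lorentzNorm_two_two hΩL.1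
  have hΩm : MemLp Ω 2 μ := ⟨hΩL.1, hnorm ▸ hΩL.2⟩
  have hΩ := memL2_coord hΩm
  set N := eLpNorm Ω 2 μ with hN
  obtain ⟨P, X, h, hmin⟩ := exists_minimizer hΩa hΩ
  obtain ⟨ξ, hξa, hξm, hξ0, hξ1, hξb⟩ := h.exists_potential hΩ hmin
  have hX0 : formEnergy X ≤ formEnergy Ω := by
    refine (hmin _ _ (isAdmissible_one hΩa hΩ)).trans_eq ?_
    simp [formEnergy]
  have hΩE := ofReal_formEnergy_le hΩm
  have hXE : ENNReal.ofReal (formEnergy X) ≤ (2 * n ^ 2 : ℕ) * N ^ 2 :=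
    (ENNReal.ofReal_le_ofReal hX0).trans hΩE
  have hmono : ∀ {k : ℕ} {f : Euc 2 → ℝ}, k ≤ gaugeConst n →
      ∫⁻ x, ‖f x‖ₑ ^ 2 ∂μ ≤ k * N ^ 2 → eLpNorm f 2 μ ≤ gaugeConst n * N := fun hk hf =>
    eLpNorm_le_of_lintegral_sq_le (hf.trans (by gcongr))
  have hξN : ∀ a b, eLpNorm (fun x => ξ x a b) 2 μ ≤ gaugeConst n * N := fun a b => by
    refine hmono (k := 16 * (2 * n ^ 2)) ?_ ((hξb a b).trans ?_)
    · exact Nat.mul_le_mul_right _ (by omega)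
    · rw [Nat.cast_mul, mul_assoc]
      exact mul_le_mul_right hXE _
  have hXN : ∀ i a b, eLpNorm (fun x => X x i a b) 2 μ ≤ gaugeConst n * N := fun i a b => by
    refine hmono (k := 2 * n ^ 2) ?_ ?_
    · exact Nat.le_mul_of_pos_left _ (by positivity)
    · rw [lintegral_enorm_sq_eq_ofReal (h.memLp i a b)]
      exact (ENNReal.ofReal_le_ofReal (integral_sq_le_formEnergy X i a b)).trans hXE
  have hPN : ∀ i a b, eLpNorm (fun x => (X x i * P x + P x * Ω x i) a b) 2 μ ≤
      gaugeConst n * N := fun i a b => by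
    refine hmono (k := 4 * n ^ 2 * (2 * n ^ 2)) ?_ ?_
    · exact Nat.mul_le_mul_right _ (by omega)
    · rw [lintegral_enorm_sq_eq_ofReal (h.memL2_grad hΩ i a b)]
      calc _ ≤ ENNReal.ofReal ((4 * n ^ 2 : ℕ) * formEnergy Ω) := by
            refine ENNReal.ofReal_le_ofReal ((h.integral_grad_sq_le hΩ i a b).trans ?_)
            rw [Finset.sum_const, Finset.card_univ, Fintype.card_fin, nsmul_eq_mul]
            push_cast
            nlinarith [mul_le_mul_of_nonneg_left hX0 (sq_nonneg (n : ℝ))]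
        _ = (4 * n ^ 2 : ℕ) * ENNReal.ofReal (formEnergy Ω) := by
            rw [ENNReal.ofReal_mul (Nat.cast_nonneg _), ENNReal.ofReal_natCast]
        _ ≤ _ := by
            rw [Nat.cast_mul (4 * n ^ 2), mul_assoc]
            exact mul_le_mul_right hΩE _
  set dP : Euc 2 → Fin 2 → Mat n := fun x i => X x i * P x + P x * Ω x i with hdP
  set dξ : Euc 2 → Fin 2 → Mat n := fun x => ![-X x 1, X x 0] with hdξ
  have hdξm : ∀ i a b, MemL2 fun x => dξ x i a b := fun i a b => by
    fin_cases i
    · exact (h.memLp 1 a b).neg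
    · exact h.memLp 0 a b
  have hdξN : ∀ i a b, eLpNorm (fun x => dξ x i a b) 2 μ ≤ gaugeConst n * N := fun i a b => by
    fin_cases i
    · exact (eLpNorm_neg (fun x => X x 1 a b) 2 μ).trans_le (hXN 1 a b)
    · exact hXN 0 a b
  have hdξ' : ∀ i, HasWeakDeriv (ballUnit 2) (single1 i) ξ fun x => dξ x i := fun i => by
    refine hasWeakDeriv_matrix hξm (hdξm i) fun a b => ?_
    fin_cases i
    · exact hξ0 a b
    · exact hξ1 a b
  have hdPm := h.memL2_grad hΩ
  have hdP' : ∀ i, HasWeakDeriv (ballUnit 2) (single1 i) P fun x => dP x i := fun i =>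
    hasWeakDeriv_matrix h.memL2_apply (hdPm i) (h.wd i)
  have hassoc : ∀ {F : Euc 2 → Mat n}, (∀ a b, MemL2 fun x => F x a b) →
      (∀ a b, eLpNorm (fun x => F x a b) 2 μ ≤ gaugeConst n * N) →
      eLpNorm F 2 μ ≤ K * N := fun hm hb => by
    rw [hK, Nat.cast_mul, mul_assoc]
    exact eLpNorm_matrix_le hm hb
  refine ⟨P, dP, ξ, dξ, fun x _ => h.isSO x, hξa,
    memSL_one (memLp_matrix h.memL2_apply) (fun i => memLp_matrix (hdPm i)) hdP',
    memSL_one (memLp_matrix hξm) (fun i => memLp_matrix (hdξm i)) hdξ', hdP', hdξ',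
    Filter.Eventually.of_forall fun x i => ?_, ?_⟩
  · have hinv : (P x)⁻¹ * P x = 1 := Matrix.nonsing_inv_mul _ (by simp [(h.isSO x).2])
    have hperp : perp (dξ x) i = -X x i := by
      fin_cases i <;> simp [perp, hdξ]
    rw [hperp, hdP]
    simp only [mul_add, mul_neg, neg_mul, ← mul_assoc, hinv, one_mul]
    abel
  · have hdPf : ∀ i, MemLp (fun x => dP x i) 2 μ := fun i => memLp_matrix (hdPm i)
    rw [lorentzNormOn_two_two (memLp_form hdPf), hnorm]
    calc _ ≤ (mIdx 2 1).card * (K * N) + (K * N + K * N) := by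
          refine add_le_add (slNorm_one_le (memLp_matrix hξm) (fun i => memLp_matrix (hdξm i)) hdξ'
            (hassoc hξm hξN) fun i => hassoc (hdξm i) (hdξN i)) ?_
          exact (eLpNorm_form_le hdPf).trans
            (add_le_add (hassoc (hdPm 0) (hPN 0)) (hassoc (hdPm 1) (hPN 1)))
      _ = ((mIdx 2 1).card * K + 2 * K : ℕ) * N := by
          push_cast
          ring
      _ ≤ _ := mul_le_mul' (Nat.cast_le.2 (Nat.le_succ _)) le_rfl
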